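/- Let A = KQ/I be a finite-dimensional algebra over an algebraically closed field K, where Q is a finite quiver containing no loop and I is an admissible ideal of the path algebra KQ. Then A is geometrically irreducible if and only if A is hereditary (i.e. the global dimension of A is at most 1). -/

import Mathlib

open scoped BigOperators

noncomputable section
/-! ## Quivers and paths -/

/-- A finite quiver: finite sets of vertices and arrows together with source and
target maps. -/
structure FinQuiver : Type 1 where
  V : Type
  A : Type
  [fintypeV : Fintype V]
  [fintypeA : Fintype A]
  [decEqV : DecidableEq V]
  [decEqA : DecidableEq A]
  src : A → V
  tgt : A → V

attribute [instance] FinQuiver.fintypeV FinQuiver.fintypeA FinQuiver.decEqV FinQuiver.decEqA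

/-- A path of positive length in a quiver: a list of composable arrows `[a₁, …, aₘ]`
satisfying `s (aᵢ) = t (aᵢ₊₁)`. -/
structure QPath (Q : FinQuiver) : Type where
  arrows : List Q.A
  ne : arrows ≠ []
  chain : arrows.Chain' fun a b => Q.src a = Q.tgt b

namespace QPath

variable {Q : FinQuiver}

/-- The length of a path. -/
def length (p : QPath Q) : ℕ := p.arrows.length

/-- The target `t (a₁)` of a path `(a₁, …, aₘ)`. -/
def tgt (p : QPath Q) : Q.V := Q.tgt (p.arrows.head p.ne)

/-- The source `s (aₘ)` of a path `(a₁, …, aₘ)`. -/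
def src (p : QPath Q) : Q.V := Q.src (p.arrows.getLast p.ne)

/-- A path is a cycle if its source equals its target. -/
def IsCycle (p : QPath Q) : Prop := p.src = p.tgt

/-- A cycle `(a₁, …, aₘ)` is primitive if the vertices `s (a₁), …, s (aₘ)` are pairwise
different. -/
def IsPrimitive (p : QPath Q) : Prop := (p.arrows.map Q.src).Nodup

end QPath

/-! ## The path algebra, relations, admissible ideals and representation varieties -/

/-- The defining relations presenting the path algebra `KQ` as a quotient of the free
algebra on the vertices and arrows of `Q`: the vertices become a complete set of
orthogonal idempotents summing to `1`, and `e_{t(a)} * a = a = a * e_{s(a)}` for every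
arrow `a`. -/
inductive PathRel (K : Type) [Field K] (Q : FinQuiver) :
    FreeAlgebra K (Q.V ⊕ Q.A) → FreeAlgebra K (Q.V ⊕ Q.A) → Prop
  | idem (i : Q.V) : PathRel K Q
      (FreeAlgebra.ι K (Sum.inl i) * FreeAlgebra.ι K (Sum.inl i)) (FreeAlgebra.ι K (Sum.inl i))
  | orth (i j : Q.V) (h : i ≠ j) : PathRel K Q
      (FreeAlgebra.ι K (Sum.inl i) * FreeAlgebra.ι K (Sum.inl j)) 0
  | sum_one : PathRel K Q (∑ i : Q.V, FreeAlgebra.ι K (Sum.inl i)) 1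
  | tgt_mul (a : Q.A) : PathRel K Q
      (FreeAlgebra.ι K (Sum.inl (Q.tgt a)) * FreeAlgebra.ι K (Sum.inr a))
      (FreeAlgebra.ι K (Sum.inr a))
  | mul_src (a : Q.A) : PathRel K Q
      (FreeAlgebra.ι K (Sum.inr a) * FreeAlgebra.ι K (Sum.inl (Q.src a)))
      (FreeAlgebra.ι K (Sum.inr a))

/-- The path algebra `KQ`. -/
abbrev PathAlgebra (K : Type) [Field K] (Q : FinQuiver) : Type := RingQuot (PathRel K Q)

variable (K : Type) [Field K] (Q : FinQuiver)

/-- The idempotent `eᵢ ∈ KQ` corresponding to a vertex `i` (the path of length zero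
at `i`). -/
def vertexElem (i : Q.V) : PathAlgebra K Q :=
  RingQuot.mkAlgHom K (PathRel K Q) (FreeAlgebra.ι K (Sum.inl i))

/-- The element of `KQ` corresponding to an arrow `a`. -/
def arrowElem (a : Q.A) : PathAlgebra K Q :=
  RingQuot.mkAlgHom K (PathRel K Q) (FreeAlgebra.ι K (Sum.inr a))

/-- The element of `KQ` corresponding to a path `(a₁, …, aₘ)`, namely `a₁ ⋯ aₘ`. -/
def pathElem (p : QPath Q) : PathAlgebra K Q := (p.arrows.map (arrowElem K Q)).prod

/-- The element `∑ₚ c p • p` of `KQ` determined by a finitely supported family of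
coefficients on paths. -/
def relElem (c : QPath Q →₀ K) : PathAlgebra K Q := c.sum fun p l => l • pathElem K Q p

/-- `c` is the datum of a relation with common target `i` and common source `j`: all
paths in its support have length at least two, target `i` and source `j`.  (The paths in
the support are pairwise different and have nonzero coefficients by definition of a
finitely supported function.) -/
def IsRelationData (c : QPath Q →₀ K) (i j : Q.V) : Prop :=
  ∀ p ∈ c.support, 2 ≤ p.length ∧ p.tgt = i ∧ p.src = j

/-- An element of `KQ` is a relation if it is a `K`-linear combination `∑ λₚ • p` of
pairwise different paths of length at least two having a common source and a common
target, with all `λₚ ≠ 0`. -/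
def IsRelation (x : PathAlgebra K Q) : Prop :=
  ∃ (c : QPath Q →₀ K) (i j : Q.V), IsRelationData K Q c i j ∧ x = relElem K Q c

/-- The two-sided ideal generated by a set `S`, as a set: the additive subgroup generated
by all elements `a * s * b` with `s ∈ S`. -/
def twoSidedSpan (R : Type) [Ring R] (S : Set R) : Set R :=
  (AddSubgroup.closure {x | ∃ a b : R, ∃ s ∈ S, x = a * s * b} : AddSubgroup R)

/-- `φ : KQ →ₐ[K] A` presents `A` as `KQ/I` with `I = ker φ` an admissible ideal:
`φ` is surjective, its kernel is generated (as a two-sided ideal) by a set of relations,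
and there is some `m ≥ 2` such that all paths of length at least `m` lie in the kernel. -/
def IsAdmissiblePresentation {A : Type} [Ring A] [Algebra K A]
    (φ : PathAlgebra K Q →ₐ[K] A) : Prop :=
  Function.Surjective φ ∧
  (∃ S : Set (PathAlgebra K Q), (∀ x ∈ S, IsRelation K Q x) ∧
    twoSidedSpan (PathAlgebra K Q) S = {x | φ x = 0}) ∧
  ∃ m : ℕ, 2 ≤ m ∧ ∀ p : QPath Q, m ≤ p.length → φ (pathElem K Q p) = 0

/-- The index type for the rows/columns of the matrices in a `d`-dimensional
representation: the basis vectors of `⊕ᵢ K^{dᵢ}`. -/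
abbrev RepIx (d : Q.V → ℕ) : Type := (i : Q.V) × Fin (d i)

/-- The ambient affine space of `d`-dimensional representations.  An arrow `a` gets a
matrix; membership in `RepSet` forces the matrix of `a` to be concentrated in the block
with rows indexed by the block `t(a)` and columns indexed by the block `s(a)`, i.e. to be
(the block extension of) a `d (t a) × d (s a)`-matrix. -/
abbrev RepSpace (d : Q.V → ℕ) : Type := Q.A → Matrix (RepIx Q d) (RepIx Q d) K

/-- The Zariski topology on affine space `K^ι`: generated by the complements of zero sets
of polynomials in the coordinates. -/
def zariskiTopology (ι R : Type) [CommSemiring R] : TopologicalSpace (ι → R) :=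
  TopologicalSpace.generateFrom
    {U | ∃ f : MvPolynomial ι R, U = {x | MvPolynomial.eval x f ≠ 0}}

/-- The Zariski topology on the ambient space of `d`-dimensional representations. -/
def repTopology (d : Q.V → ℕ) : TopologicalSpace (RepSpace K Q d) :=
  TopologicalSpace.induced (fun M (x : Q.A × RepIx Q d × RepIx Q d) => M x.1 x.2.1 x.2.2)
    (zariskiTopology (Q.A × RepIx Q d × RepIx Q d) K)

/-- The condition that the matrix of each arrow `a` is concentrated in the
`(t a, s a)`-block, i.e. really is a `d (t a) × d (s a)`-matrix. -/
def BlockCompatible (d : Q.V → ℕ) (M : RepSpace K Q d) : Prop :=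
  ∀ (a : Q.A) (u v : RepIx Q d), M a u v ≠ 0 → u.1 = Q.tgt a ∧ v.1 = Q.src a

/-- The evaluation `M(p) = M(a₁) ⋯ M(aₘ)` of a representation at a path. -/
def pathProd (d : Q.V → ℕ) (M : RepSpace K Q d) (p : QPath Q) :
    Matrix (RepIx Q d) (RepIx Q d) K := (p.arrows.map M).prod

/-- The evaluation `M(ρ) = ∑ λₚ M(p)` of a representation at a linear combination of
paths. -/
def relEval (d : Q.V → ℕ) (M : RepSpace K Q d) (c : QPath Q →₀ K) :
    Matrix (RepIx Q d) (RepIx Q d) K := c.sum fun p l => l • pathProd K Q d M p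

/-- The affine variety `rep(A, d)` of `d`-dimensional representations of `A = KQ/I`,
where `I = ker φ`: tuples of matrices (of the correct block sizes) with `M(ρ) = 0` for
every relation `ρ ∈ I`. -/
def RepSet {A : Type} [Ring A] [Algebra K A] (φ : PathAlgebra K Q →ₐ[K] A) (d : Q.V → ℕ) :
    Set (RepSpace K Q d) :=
  {M | BlockCompatible K Q d M ∧
    ∀ (c : QPath Q →₀ K) (i j : Q.V), IsRelationData K Q c i j →
      φ (relElem K Q c) = 0 → relEval K Q d M c = 0}

/-- `A = KQ/I` (presented by `φ`, with `I = ker φ`) is geometrically irreducible if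
`rep(A, d)` is an irreducible topological space for every dimension vector `d`. -/
def IsGeomIrreducible {A : Type} [Ring A] [Algebra K A] (φ : PathAlgebra K Q →ₐ[K] A) :
    Prop :=
  ∀ d : Q.V → ℕ, @IsIrreducible _ (repTopology K Q d) (RepSet K Q φ d)

/-! ## Projective and injective dimension -/

/-- `HasProjDimLE A n M` : the `A`-module `M` has projective dimension at most `n`,
i.e. there is a projective resolution `0 → Pₙ → ⋯ → P₀ → M → 0`. -/
def HasProjDimLE (A : Type) [Ring A] : ℕ → ModuleCat.{0} A → Prop
  | 0, M => Module.Projective A M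
  | n + 1, M => ∃ (P : ModuleCat.{0} A) (f : P →ₗ[A] M), Module.Projective A P ∧
      Function.Surjective f ∧ HasProjDimLE A n (ModuleCat.of A ↥(LinearMap.ker f))

/-- `HasInjDimLE A n M` : the `A`-module `M` has injective dimension at most `n`,
i.e. there is an injective coresolution `0 → M → I⁰ → ⋯ → Iⁿ → 0`. -/
def HasInjDimLE (A : Type) [Ring A] : ℕ → ModuleCat.{0} A → Prop
  | 0, M => Module.Injective A M
  | n + 1, M => ∃ (I : ModuleCat.{0} A) (f : M →ₗ[A] I), Module.Injective A I ∧
      Function.Injective f ∧ HasInjDimLE A n (ModuleCat.of A (↥I ⧸ LinearMap.range f))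

/-- A ring is hereditary iff its (left) global dimension is at most one, i.e. every
module has projective dimension at most `1`. -/
def IsHereditaryRing (A : Type) [Ring A] : Prop :=
  ∀ M : ModuleCat.{0} A, HasProjDimLE A 1 M

/-- A ring has finite (left) global dimension if there is a simultaneous bound on the
projective dimensions of all modules. -/
def HasFiniteGlobalDimension (A : Type) [Ring A] : Prop :=
  ∃ n : ℕ, ∀ M : ModuleCat.{0} A, HasProjDimLE A n M

/-! ## Generators of the path algebra -/

section PathAlgebra

variable {K Q}

lemma vertexElem_mul_self (i : Q.V) :
    vertexElem K Q i * vertexElem K Q i = vertexElem K Q i := by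
  simpa only [vertexElem, map_mul] using RingQuot.mkAlgHom_rel K (PathRel.idem (K := K) i)

lemma vertexElem_mul_of_ne {i j : Q.V} (h : i ≠ j) :
    vertexElem K Q i * vertexElem K Q j = 0 := by
  simpa only [vertexElem, map_mul, map_zero] using
    RingQuot.mkAlgHom_rel K (PathRel.orth (K := K) i j h)

variable (K Q) in
lemma sum_vertexElem : ∑ i : Q.V, vertexElem K Q i = 1 := by
  simpa only [vertexElem, map_sum, map_one] using
    RingQuot.mkAlgHom_rel K (PathRel.sum_one (K := K) (Q := Q))

lemma vertexElem_tgt_mul (a : Q.A) :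
    vertexElem K Q (Q.tgt a) * arrowElem K Q a = arrowElem K Q a := by
  simpa only [vertexElem, arrowElem, map_mul] using
    RingQuot.mkAlgHom_rel K (PathRel.tgt_mul (K := K) a)

lemma arrowElem_mul_vertexElem_src (a : Q.A) :
    arrowElem K Q a * vertexElem K Q (Q.src a) = arrowElem K Q a := by
  simpa only [vertexElem, arrowElem, map_mul] using
    RingQuot.mkAlgHom_rel K (PathRel.mul_src (K := K) a)

lemma arrowElem_mul_vertexElem_of_ne {a : Q.A} {v : Q.V} (h : Q.src a ≠ v) :
    arrowElem K Q a * vertexElem K Q v = 0 := by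
  rw [← arrowElem_mul_vertexElem_src, mul_assoc, vertexElem_mul_of_ne h, mul_zero]

lemma arrowElem_mul_arrowElem_of_ne {a b : Q.A} (h : Q.src a ≠ Q.tgt b) :
    arrowElem K Q a * arrowElem K Q b = 0 := by
  rw [← vertexElem_tgt_mul b, ← mul_assoc, arrowElem_mul_vertexElem_of_ne h, zero_mul]

lemma prod_arrowElem_eq_zero (l : List Q.A)
    (hl : ¬ l.IsChain fun a b => Q.src a = Q.tgt b) : (l.map (arrowElem K Q)).prod = 0 := by
  induction l with
  | nil => exact absurd .nil hl
  | cons a l ih =>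
    cases l with
    | nil => exact absurd (.singleton a) hl
    | cons b l =>
      rw [List.isChain_cons_cons, not_and_or] at hl
      rcases hl with hl | hl
      · simp only [List.map_cons, List.prod_cons, ← mul_assoc, arrowElem_mul_arrowElem_of_ne hl,
          zero_mul]
      · rw [List.map_cons, List.prod_cons, ih hl, mul_zero]

/-- The universal property of the path algebra. -/
def pathAlgebraLift {B : Type*} [Ring B] [Algebra K B] (e : Q.V → B) (x : Q.A → B)
    (idem : ∀ i, e i * e i = e i) (orth : ∀ i j, i ≠ j → e i * e j = 0) (sum_one : ∑ i, e i = 1)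
    (tgt_mul : ∀ a, e (Q.tgt a) * x a = x a) (mul_src : ∀ a, x a * e (Q.src a) = x a) :
    PathAlgebra K Q →ₐ[K] B :=
  RingQuot.liftAlgHom K ⟨FreeAlgebra.lift K (Sum.elim e x), fun y z h => by
    cases h with
    | idem i => simp [idem]
    | orth i j h => simp [orth i j h]
    | sum_one => simp [sum_one]
    | tgt_mul a => simp [tgt_mul]
    | mul_src a => simp [mul_src]⟩

section

variable {B : Type*} [Ring B] [Algebra K B] {e : Q.V → B} {x : Q.A → B}
    {h₁ : ∀ i, e i * e i = e i} {h₂ : ∀ i j, i ≠ j → e i * e j = 0} {h₃ : ∑ i, e i = 1}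
    {h₄ : ∀ a, e (Q.tgt a) * x a = x a} {h₅ : ∀ a, x a * e (Q.src a) = x a}

@[simp] lemma pathAlgebraLift_vertexElem (i : Q.V) :
    pathAlgebraLift (K := K) e x h₁ h₂ h₃ h₄ h₅ (vertexElem K Q i) = e i := by
  simp [pathAlgebraLift, vertexElem]

@[simp] lemma pathAlgebraLift_arrowElem (a : Q.A) :
    pathAlgebraLift (K := K) e x h₁ h₂ h₃ h₄ h₅ (arrowElem K Q a) = x a := by
  simp [pathAlgebraLift, arrowElem]

end

/-- The subspaces of the path algebra containing `1` and stable under right multiplication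
by the generators are everything. -/
lemma eq_top_of_mul_mem (T : Submodule K (PathAlgebra K Q)) (one_mem : 1 ∈ T)
    (vertex : ∀ x ∈ T, ∀ v, x * vertexElem K Q v ∈ T)
    (arrow : ∀ x ∈ T, ∀ a, x * arrowElem K Q a ∈ T) : T = ⊤ := by
  have key : ∀ w : FreeAlgebra K (Q.V ⊕ Q.A), ∀ x ∈ T,
      x * RingQuot.mkAlgHom K (PathRel K Q) w ∈ T := by
    intro w
    induction w using FreeAlgebra.induction with
    | grade0 r =>
      intro x hx
      rw [AlgHom.commutes, ← Algebra.commutes, ← Algebra.smul_def]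
      exact T.smul_mem r hx
    | grade1 g =>
      rcases g with v | a
      · exact fun x hx => vertex x hx v
      · exact fun x hx => arrow x hx a
    | mul a b ha hb =>
      intro x hx
      rw [map_mul, ← mul_assoc]
      exact hb _ (ha x hx)
    | add a b ha hb =>
      intro x hx
      rw [map_add, mul_add]
      exact T.add_mem (ha x hx) (hb x hx)
  rw [eq_top_iff]
  intro y _
  obtain ⟨w, rfl⟩ := RingQuot.mkAlgHom_surjective K (PathRel K Q) y
  simpa using key w 1 one_mem

lemma map_relElem {B : Type*} [Ring B] [Algebra K B] (f : PathAlgebra K Q →ₐ[K] B)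
    (c : QPath Q →₀ K) :
    f (relElem K Q c) =
      c.sum fun p l => l • (p.arrows.map fun a => f (arrowElem K Q a)).prod := by
  simp only [relElem, Finsupp.sum, map_sum, map_smul, pathElem, map_list_prod, List.map_map,
    Function.comp_def]

/-- A path of length at least two is sent to zero once all products of two composable
arrows are. -/
lemma prod_eq_zero_of_mul_eq_zero {B : Type*} [MonoidWithZero B] {x : Q.A → B}
    (hx : ∀ a b, Q.src a = Q.tgt b → x a * x b = 0) (p : QPath Q) (hp : 2 ≤ p.length) :
    (p.arrows.map x).prod = 0 := by
  obtain ⟨l, ne, chain⟩ := p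
  match l, ne, chain, hp with
  | a :: b :: l, _, chain, _ =>
    have : Q.src a = Q.tgt b := (List.isChain_cons_cons.1 chain).1
    simp only [List.map_cons, List.prod_cons, ← mul_assoc, hx a b this, zero_mul]

/-- An algebra homomorphism killing all paths of length two vanishes on the kernel of an
admissible presentation. -/
lemma eq_zero_of_map_eq_zero {A : Type} [Ring A] [Algebra K A] {φ : PathAlgebra K Q →ₐ[K] A}
    (hadm : IsAdmissiblePresentation K Q φ) {B : Type*} [Ring B] [Algebra K B]
    (f : PathAlgebra K Q →ₐ[K] B)
    (hf : ∀ a b, Q.src a = Q.tgt b → f (arrowElem K Q a) * f (arrowElem K Q b) = 0)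
    {x : PathAlgebra K Q} (hx : φ x = 0) : f x = 0 := by
  obtain ⟨-, ⟨S, hS, hspan⟩, -⟩ := hadm
  have hx' : x ∈ twoSidedSpan (PathAlgebra K Q) S := hspan ▸ hx
  refine AddSubgroup.closure_induction (p := fun x _ => f x = 0) ?_ (map_zero f) ?_ ?_ hx'
  · rintro _ ⟨a, b, s, hs, rfl⟩
    obtain ⟨c, i, j, hc, rfl⟩ := hS s hs
    rw [map_mul, map_mul, map_relElem, Finsupp.sum, Finset.sum_eq_zero, mul_zero, zero_mul]
    intro p hp
    rw [prod_eq_zero_of_mul_eq_zero hf p (hc p hp).1, smul_zero]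
  · intro x y _ _ hx hy
    rw [map_add, hx, hy, add_zero]
  · intro x _ hx
    rw [map_neg, hx, neg_zero]

/-- The augmentation of the path algebra at a vertex. -/
def augmentation (v : Q.V) : PathAlgebra K Q →ₐ[K] K :=
  pathAlgebraLift (fun w => if w = v then 1 else 0) 0 (by simp) (fun i j h => by
    by_cases hi : i = v
    · simp [show j ≠ v from fun hj => h (hi.trans hj.symm)]
    · simp [hi]) (by simp) (by simp) (by simp)

@[simp] lemma augmentation_vertexElem (v w : Q.V) :
    augmentation v (vertexElem K Q w) = if w = v then 1 else 0 :=
  pathAlgebraLift_vertexElem w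

@[simp] lemma augmentation_arrowElem (v : Q.V) (a : Q.A) :
    augmentation v (arrowElem K Q a) = 0 :=
  pathAlgebraLift_arrowElem a

/-- The representation that is one-dimensional at every vertex, with a single arrow acting
nontrivially. -/
def arrowRep (a : Q.A) : PathAlgebra K Q →ₐ[K] Matrix Q.V Q.V K :=
  pathAlgebraLift (fun v => Matrix.single v v 1)
    (fun b => if b = a then Matrix.single (Q.tgt a) (Q.src a) 1 else 0) (by simp)
    (fun i j h => Matrix.single_mul_single_of_ne _ _ _ _ h _)
    (by
      ext i j
      rw [Matrix.sum_apply]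
      by_cases h : i = j
      · subst h
        simp [Matrix.single_apply]
      · rw [Matrix.one_apply_ne h]
        refine Finset.sum_eq_zero fun k _ => ?_
        rw [Matrix.single_apply, if_neg]
        exact fun hk => h (hk.1.symm.trans hk.2))
    (fun b => by by_cases h : b = a <;> simp [h])
    (fun b => by by_cases h : b = a <;> simp [h])

lemma arrowRep_vertexElem (a : Q.A) (v : Q.V) :
    arrowRep a (vertexElem K Q v) = Matrix.single v v 1 :=
  pathAlgebraLift_vertexElem v

lemma arrowRep_arrowElem (a b : Q.A) :
    arrowRep a (arrowElem K Q b) =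
      if b = a then Matrix.single (Q.tgt a) (Q.src a) 1 else 0 :=
  pathAlgebraLift_arrowElem b

lemma arrowRep_apply_self (hnoloop : ∀ a : Q.A, Q.src a ≠ Q.tgt a) (a : Q.A)
    (x : PathAlgebra K Q) :
    arrowRep a x (Q.tgt a) (Q.tgt a) = augmentation (Q.tgt a) x := by
  let T : Submodule K (PathAlgebra K Q) := LinearMap.eqLocus
    (Matrix.entryLinearMap K K (Q.tgt a) (Q.tgt a) ∘ₗ (arrowRep a).toLinearMap)
    (augmentation (Q.tgt a)).toLinearMap
  have hT (y) : y ∈ T ↔ arrowRep a y (Q.tgt a) (Q.tgt a) = augmentation (Q.tgt a) y :=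
    Iff.rfl
  rw [← hT, eq_top_of_mul_mem T]
  · trivial
  · simp [hT]
  · intro y hy v
    rw [hT] at hy ⊢
    rw [map_mul, map_mul, arrowRep_vertexElem, augmentation_vertexElem]
    by_cases hv : v = Q.tgt a
    · subst hv
      simpa using hy
    · simp [hv, Ne.symm hv, Matrix.mul_single_apply_of_ne]
  · intro y hy b
    rw [hT, map_mul, map_mul, augmentation_arrowElem, arrowRep_arrowElem, mul_zero]
    by_cases hb : b = a
    · simp [hb, Matrix.mul_single_apply_of_ne, (hnoloop a).symm]
    · simp [hb]

end PathAlgebra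

/-! ## The arrow ideal of an admissible quotient -/

section Hereditary

variable {K Q} {A : Type} [Ring A] [Algebra K A] (φ : PathAlgebra K Q →ₐ[K] A)

/-- The left ideal generated by the images of all products of `n` arrows. -/
def arrowPow (n : ℕ) : Ideal A :=
  Ideal.span {x | ∃ l : List Q.A, l.length = n ∧ x = (l.map fun a => φ (arrowElem K Q a)).prod}

variable {φ}

lemma prod_mem_arrowPow (l : List Q.A) :
    (l.map fun a => φ (arrowElem K Q a)).prod ∈ arrowPow φ l.length :=
  Ideal.subset_span ⟨l, rfl, rfl⟩

lemma mul_arrow_mem_arrowPow {n : ℕ} {y : A} (hy : y ∈ arrowPow φ n) (a : Q.A) :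
    y * φ (arrowElem K Q a) ∈ arrowPow φ (n + 1) := by
  refine Submodule.span_induction (p := fun y _ => y * φ (arrowElem K Q a) ∈ arrowPow φ (n + 1))
    ?_ (by simp) ?_ ?_ hy
  · rintro _ ⟨l, rfl, rfl⟩
    simpa using prod_mem_arrowPow (φ := φ) (l ++ [a])
  · intro x y _ _ hx hy
    rw [add_mul]
    exact add_mem hx hy
  · intro r x _ hx
    rw [smul_mul_assoc]
    exact Submodule.smul_mem _ r hx

variable (φ) in
lemma arrowPow_succ_le (n : ℕ) : arrowPow φ (n + 1) ≤ arrowPow φ n := by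
  refine Ideal.span_le.2 ?_
  rintro _ ⟨l, hl, rfl⟩
  cases l with
  | nil => simp at hl
  | cons a l =>
    obtain rfl : l.length = n := by simpa using hl
    exact Ideal.mul_mem_left _ _ (prod_mem_arrowPow l)

variable (φ) in
@[simp] lemma arrowPow_zero : arrowPow φ 0 = ⊤ :=
  (Ideal.eq_top_iff_one _).2 (prod_mem_arrowPow [])

lemma mul_map_mem_arrowPow {n : ℕ} {y : A} (hy : y ∈ arrowPow φ n) (x : PathAlgebra K Q) :
    y * φ x ∈ arrowPow φ n := by
  let T : Submodule K (PathAlgebra K Q) := ((arrowPow φ n).restrictScalars K).comap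
    (LinearMap.mulLeft K y ∘ₗ φ.toLinearMap)
  have hT (z) : z ∈ T ↔ y * φ z ∈ arrowPow φ n := Iff.rfl
  rw [← hT, eq_top_of_mul_mem T]
  · trivial
  · simpa [hT] using hy
  · intro z hz v
    rw [hT] at hz ⊢
    rw [map_mul, ← mul_assoc]
    refine Submodule.span_induction
      (p := fun w _ => w * φ (vertexElem K Q v) ∈ arrowPow φ n) ?_ (by simp) ?_ ?_ hz
    · rintro _ ⟨l, rfl, rfl⟩
      rcases List.eq_nil_or_concat l with rfl | ⟨l, a, rfl⟩
      · simp
      · rw [List.concat_eq_append, List.map_append, List.prod_append, List.map_singleton,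
          List.prod_singleton, mul_assoc, ← map_mul]
        by_cases h : Q.src a = v
        · subst h
          rw [arrowElem_mul_vertexElem_src]
          simpa using prod_mem_arrowPow (φ := φ) (l ++ [a])
        · rw [arrowElem_mul_vertexElem_of_ne h, map_zero, mul_zero]
          exact zero_mem _
    · intro x y _ _ hx hy
      rw [add_mul]
      exact add_mem hx hy
    · intro r x _ hx
      rw [smul_mul_assoc]
      exact Submodule.smul_mem _ r hx
  · intro z hz a
    rw [hT] at hz ⊢
    rw [map_mul, ← mul_assoc]
    exact arrowPow_succ_le φ n (mul_arrow_mem_arrowPow hz a)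

variable (φ) in
lemma arrowPow_one :
    arrowPow φ 1 = Submodule.span A (Set.range fun a => φ (arrowElem K Q a)) := by
  refine congrArg _ (Set.ext fun x => ⟨?_, ?_⟩)
  · rintro ⟨l, hl, rfl⟩
    obtain ⟨a, rfl⟩ := List.length_eq_one_iff.1 hl
    exact ⟨a, by simp⟩
  · rintro ⟨a, rfl⟩
    exact ⟨[a], rfl, by simp⟩

lemma mul_mem_arrowPow_succ (hφ : Function.Surjective φ) {n : ℕ} {y z : A}
    (hy : y ∈ arrowPow φ n) (hz : z ∈ arrowPow φ 1) : y * z ∈ arrowPow φ (n + 1) := by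
  rw [arrowPow_one] at hz
  have key : ∀ y ∈ arrowPow φ n, y * z ∈ arrowPow φ (n + 1) := by
    refine Submodule.span_induction
      (p := fun z _ => ∀ y ∈ arrowPow φ n, y * z ∈ arrowPow φ (n + 1)) ?_ (by simp) ?_ ?_ hz
    · rintro _ ⟨a, rfl⟩ y hy
      exact mul_arrow_mem_arrowPow hy a
    · intro x z _ _ hx hz y hy
      rw [mul_add]
      exact add_mem (hx y hy) (hz y hy)
    · intro r x _ hx y hy
      obtain ⟨r, rfl⟩ := hφ r
      rw [smul_eq_mul, ← mul_assoc]
      exact hx _ (mul_map_mem_arrowPow hy r)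
  exact key y hy

lemma exists_arrowPow_eq_bot (hadm : IsAdmissiblePresentation K Q φ) :
    ∃ m, arrowPow φ m = ⊥ := by
  obtain ⟨-, -, m, hm, h⟩ := hadm
  refine ⟨m, Ideal.span_eq_bot.2 ?_⟩
  rintro _ ⟨l, hl, rfl⟩
  have : (l.map fun a => φ (arrowElem K Q a)).prod = φ (l.map (arrowElem K Q)).prod := by
    simp only [map_list_prod, List.map_map, Function.comp_def]
  rw [this]
  by_cases hc : l.IsChain fun a b => Q.src a = Q.tgt b
  · exact h ⟨l, by rintro rfl; simp at hl; omega, hc⟩ hl.ge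
  · rw [prod_arrowElem_eq_zero l hc, map_zero]

lemma map_mem_arrowPow_one {x : PathAlgebra K Q} (hx : ∀ v, augmentation v x = 0) :
    φ x ∈ arrowPow φ 1 := by
  let T : Submodule K (PathAlgebra K Q) := ((arrowPow φ 1).restrictScalars K).comap
    (φ.toLinearMap - ∑ v, (augmentation v).toLinearMap.smulRight (φ (vertexElem K Q v)))
  have hT (z) : z ∈ T ↔ φ z - ∑ v, augmentation v z • φ (vertexElem K Q v) ∈ arrowPow φ 1 := by
    simp [T]
  have key : x ∈ T := by
    rw [eq_top_of_mul_mem T]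
    · trivial
    · simp [hT, ← map_sum, sum_vertexElem]
    · intro z hz w
      rw [hT] at hz ⊢
      convert mul_map_mem_arrowPow hz (vertexElem K Q w) using 1
      rw [map_mul, sub_mul, Finset.sum_mul]
      congr 1
      refine Finset.sum_congr rfl fun v _ => ?_
      by_cases h : w = v
      · rw [h, map_mul, smul_mul_assoc, ← map_mul φ, vertexElem_mul_self]
        simp
      · rw [map_mul, smul_mul_assoc, ← map_mul φ, vertexElem_mul_of_ne (Ne.symm h)]
        simp [h]
    · intro z hz a
      rw [hT] at hz ⊢
      simpa using mul_arrow_mem_arrowPow (n := 0) (φ := φ) (y := φ z) (by simp) a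
  simpa [hT, hx] using key

/-- If the arrow ideal is projective, then it is freely generated by the arrows, relative to
the idempotents at their targets. -/
lemma eq_zero_of_sum_mul_arrow_eq_zero (hnoloop : ∀ a : Q.A, Q.src a ≠ Q.tgt a)
    (hadm : IsAdmissiblePresentation K Q φ) (hproj : Module.Projective A (arrowPow φ 1))
    {x : Q.A → A} (hx : ∀ a, x a * φ (vertexElem K Q (Q.tgt a)) = x a)
    (hsum : ∑ a, x a * φ (arrowElem K Q a) = 0) : x = 0 := by
  let f₀ : (Q.A → A) →ₗ[A] A := Fintype.linearCombination A fun a => φ (arrowElem K Q a)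
  have hf₀ (y) : f₀ y = ∑ a, y a * φ (arrowElem K Q a) := Fintype.linearCombination_apply ..
  have hrange : LinearMap.range f₀ = arrowPow φ 1 := by
    rw [arrowPow_one]
    exact Fintype.range_linearCombination ..
  let f : (Q.A → A) →ₗ[A] arrowPow φ 1 := f₀.codRestrict _ fun y => hrange ▸ ⟨y, rfl⟩
  have hf : Function.Surjective f := by
    rintro ⟨y, hy⟩
    rw [← hrange] at hy
    obtain ⟨z, rfl⟩ := hy
    exact ⟨z, rfl⟩
  obtain ⟨s, hs⟩ := Module.projective_lifting_property f LinearMap.id hf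
  let π : (Q.A → A) →ₗ[A] (Q.A → A) := LinearMap.pi fun a =>
    LinearMap.toSpanSingleton A A (φ (vertexElem K Q (Q.tgt a))) ∘ₗ LinearMap.proj a
  have hπ (y a) : π y a = y a * φ (vertexElem K Q (Q.tgt a)) := rfl
  have hππ (y) : π (π y) = π y := by
    ext a
    rw [hπ, hπ, mul_assoc, ← map_mul, vertexElem_mul_self]
  have hfπ (y) : f (π y) = f y := by
    ext
    change f₀ (π y) = f₀ y
    simp only [hf₀, hπ, mul_assoc, ← map_mul, vertexElem_tgt_mul]
  let h : (Q.A → A) →ₗ[A] (Q.A → A) := π - π ∘ₗ s ∘ₗ f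
  have hh (y) : h y = π (y - s (f y)) := by simp [h]
  have hfh (y) : f (h y) = 0 := by
    rw [hh, hfπ, map_sub, ← LinearMap.comp_apply f s, hs, LinearMap.id_apply, sub_self]
  have hmem (y a) : h y a ∈ arrowPow φ 1 := by
    have hw : ∀ b, ∃ z, φ z = h y b := fun b => hadm.1 (h y b)
    choose z hz using hw
    have hze (b) : φ (z b * vertexElem K Q (Q.tgt b)) = h y b := by
      rw [map_mul, hz, hh, ← hπ, hππ]
    have h0 : φ (∑ b, z b * arrowElem K Q b) = 0 := by
      have := congrArg Subtype.val (hfh y)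
      simpa [f, hf₀, hz] using this
    have h1 : arrowRep a (∑ b, z b * arrowElem K Q b) = 0 := by
      refine eq_zero_of_map_eq_zero hadm _ (fun b c hbc => ?_) h0
      rw [arrowRep_arrowElem, arrowRep_arrowElem]
      by_cases hb : b = a
      · by_cases hc : c = a
        · subst hb hc
          exact absurd hbc (hnoloop _)
        · simp [hc]
      · simp [hb]
    have h2 : augmentation (Q.tgt a) (z a) = 0 := by
      have := congrFun (congrFun h1 (Q.tgt a)) (Q.src a)
      rw [← arrowRep_apply_self hnoloop]
      simpa [arrowRep_arrowElem] using this
    rw [← hze]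
    refine map_mem_arrowPow_one fun v => ?_
    by_cases hv : Q.tgt a = v
    · subst hv
      rw [map_mul, h2, zero_mul]
    · simp [hv]
  have hstep (n : ℕ) (y) (hy : ∀ a, y a ∈ arrowPow φ n) (a) : h y a ∈ arrowPow φ (n + 1) := by
    rw [LinearMap.pi_apply_eq_sum_univ h y, Finset.sum_apply]
    exact sum_mem fun b _ => mul_mem_arrowPow_succ hadm.1 (hy b) (hmem _ a)
  have hfx : f x = 0 := by
    ext
    change f₀ x = 0
    rw [hf₀, hsum]
  have hhx : h x = x := by
    rw [hh, hfx, map_zero, sub_zero]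
    ext a
    rw [hπ, hx]
  have hall (n : ℕ) : ∀ a, x a ∈ arrowPow φ n := by
    induction n with
    | zero => simp
    | succ n ih =>
      rw [← hhx]
      exact hstep n x ih
  obtain ⟨m, hm⟩ := exists_arrowPow_eq_bot hadm
  ext a
  simpa [hm] using hall m a

/-! ## The length filtration of the path algebra -/

variable (K Q) in
/-- The map sending coefficients `μ` and `z` to `∑ μ v • e v + ∑ z a * a`. -/
def appendArrow : (Q.V → K) × (Q.A → PathAlgebra K Q) →ₗ[K] PathAlgebra K Q :=
  (Fintype.linearCombination K (vertexElem K Q)).coprod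
    (∑ a, LinearMap.mulRight K (arrowElem K Q a) ∘ₗ LinearMap.proj a)

lemma appendArrow_apply (μ : Q.V → K) (z : Q.A → PathAlgebra K Q) :
    appendArrow K Q (μ, z) = ∑ v, μ v • vertexElem K Q v + ∑ a, z a * arrowElem K Q a := by
  simp [appendArrow, Fintype.linearCombination_apply]

variable (K Q) in
/-- The subspace of the path algebra spanned by the paths of length less than `n`. -/
def lengthFiltration : ℕ → Submodule K (PathAlgebra K Q)
  | 0 => ⊥
  | n + 1 => Submodule.map (appendArrow K Q)
      (Submodule.prod ⊤ (Submodule.pi Set.univ fun _ => lengthFiltration n))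

lemma mem_lengthFiltration_succ {n : ℕ} {x : PathAlgebra K Q} :
    x ∈ lengthFiltration K Q (n + 1) ↔ ∃ (μ : Q.V → K) (z : Q.A → PathAlgebra K Q),
      (∀ a, z a ∈ lengthFiltration K Q n) ∧
        ∑ v, μ v • vertexElem K Q v + ∑ a, z a * arrowElem K Q a = x := by
  simp [lengthFiltration, appendArrow_apply, Submodule.mem_map, Submodule.mem_pi]

variable (K Q) in
lemma lengthFiltration_mono : Monotone (lengthFiltration K Q) := by
  refine monotone_nat_of_le_succ fun n => ?_
  induction n with
  | zero => exact bot_le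
  | succ n ih =>
    intro x hx
    rw [mem_lengthFiltration_succ] at hx ⊢
    obtain ⟨μ, z, hz, rfl⟩ := hx
    exact ⟨μ, z, fun a => ih (hz a), rfl⟩

lemma mul_arrow_mem_lengthFiltration {n : ℕ} {x : PathAlgebra K Q}
    (hx : x ∈ lengthFiltration K Q n) (a : Q.A) :
    x * arrowElem K Q a ∈ lengthFiltration K Q (n + 1) := by
  refine mem_lengthFiltration_succ.2 ⟨0, Pi.single a x, fun b => ?_, ?_⟩
  · by_cases h : b = a
    · subst h
      simpa using hx
    · simp [h]
  · simp [Pi.single_apply, ite_mul]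

lemma mul_vertex_mem_lengthFiltration {n : ℕ} {x : PathAlgebra K Q}
    (hx : x ∈ lengthFiltration K Q n) (v : Q.V) :
    x * vertexElem K Q v ∈ lengthFiltration K Q n := by
  cases n with
  | zero =>
    obtain rfl : x = 0 := hx
    simp
  | succ n =>
    obtain ⟨μ, z, hz, rfl⟩ := mem_lengthFiltration_succ.1 hx
    refine mem_lengthFiltration_succ.2 ⟨fun w => if w = v then μ w else 0,
      fun a => if Q.src a = v then z a else 0, fun a => ?_, ?_⟩
    · dsimp only
      split_ifs
      · exact hz a
      · exact zero_mem _
    · rw [add_mul, Finset.sum_mul, Finset.sum_mul]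
      congr 1
      · refine Finset.sum_congr rfl fun w _ => ?_
        by_cases h : w = v
        · simp [h, vertexElem_mul_self]
        · simp [h, vertexElem_mul_of_ne h]
      · refine Finset.sum_congr rfl fun a _ => ?_
        by_cases h : Q.src a = v
        · simp [← h, mul_assoc, arrowElem_mul_vertexElem_src]
        · simp [h, mul_assoc, arrowElem_mul_vertexElem_of_ne h]

lemma exists_mem_lengthFiltration (x : PathAlgebra K Q) : ∃ n, x ∈ lengthFiltration K Q n := by
  have hT (y) : y ∈ ⨆ n, lengthFiltration K Q n ↔ ∃ n, y ∈ lengthFiltration K Q n :=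
    Submodule.mem_iSup_of_directed _ (lengthFiltration_mono K Q).directed_le
  rw [← hT, eq_top_of_mul_mem (⨆ n, lengthFiltration K Q n)]
  · trivial
  · refine (hT _).2 ⟨1, mem_lengthFiltration_succ.2 ⟨1, 0, by simp, ?_⟩⟩
    simp [sum_vertexElem]
  · intro y hy v
    obtain ⟨n, hn⟩ := (hT y).1 hy
    exact (hT _).2 ⟨n, mul_vertex_mem_lengthFiltration hn v⟩
  · intro y hy a
    obtain ⟨n, hn⟩ := (hT y).1 hy
    exact (hT _).2 ⟨n + 1, mul_arrow_mem_lengthFiltration hn a⟩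

/-- The left ideals of a hereditary ring are projective. -/
lemma projective_of_isHereditaryRing {A : Type} [Ring A] (hA : IsHereditaryRing A)
    (J : Ideal A) : Module.Projective A J := by
  obtain ⟨P, f, hP, hf, hker⟩ := hA (ModuleCat.of A (A ⧸ J))
  replace hker : Module.Projective A (LinearMap.ker f) := hker
  change P →ₗ[A] A ⧸ J at f
  obtain ⟨α, hα⟩ := Module.projective_lifting_property J.mkQ f J.mkQ_surjective
  obtain ⟨β, hβ⟩ := Module.projective_lifting_property f J.mkQ hf
  have hα' (p) : J.mkQ (α p) = f p := LinearMap.congr_fun hα p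
  have hβ' (x) : f (β x) = J.mkQ x := LinearMap.congr_fun hβ x
  let α₀ : LinearMap.ker f →ₗ[A] J := (α ∘ₗ (LinearMap.ker f).subtype).codRestrict J fun p => by
    exact (Submodule.Quotient.mk_eq_zero J).1 ((hα' p).trans p.2)
  let β₀ : J →ₗ[A] LinearMap.ker f := (β ∘ₗ J.subtype).codRestrict (LinearMap.ker f) fun x => by
    exact (hβ' x).trans ((Submodule.Quotient.mk_eq_zero J).2 x.2)
  let u : A →ₗ[A] J := (α ∘ₗ β - LinearMap.id).codRestrict J fun x => by
    refine (Submodule.Quotient.mk_eq_zero J).1 ?_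
    change J.mkQ (α (β x) - x) = 0
    rw [map_sub, hα', hβ', sub_self]
  refine .of_split (M := LinearMap.ker f × A) (β₀.prod J.subtype) (α₀.coprod (-u)) ?_
  ext x
  change α (β x) + -(α (β x) - x) = (x : A)
  abel

/-- An admissible presentation without loops is injective if the arrow ideal is projective. -/
lemma injective_of_projective_arrowPow (hnoloop : ∀ a : Q.A, Q.src a ≠ Q.tgt a)
    (hadm : IsAdmissiblePresentation K Q φ) (hproj : Module.Projective A (arrowPow φ 1)) :
    Function.Injective φ := by
  refine (injective_iff_map_eq_zero φ).2 fun x => ?_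
  obtain ⟨n, hn⟩ := exists_mem_lengthFiltration x
  induction n generalizing x with
  | zero => exact fun _ => hn
  | succ n ih =>
    intro hx
    obtain ⟨μ, z, hz, rfl⟩ := mem_lengthFiltration_succ.1 hn
    have hμ : μ = 0 := by
      ext v
      have := eq_zero_of_map_eq_zero hadm (augmentation v) (by simp) hx
      simpa [Finset.sum_ite_eq'] using this
    subst hμ
    have hsum : ∑ a, z a * arrowElem K Q a =
        ∑ a, (z a * vertexElem K Q (Q.tgt a)) * arrowElem K Q a := by
      simp only [mul_assoc, vertexElem_tgt_mul]
    simp only [Pi.zero_apply, zero_smul, Finset.sum_const_zero, zero_add, hsum] at hx ⊢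
    have h0 := eq_zero_of_sum_mul_arrow_eq_zero hnoloop hadm hproj
      (x := fun a => φ (z a * vertexElem K Q (Q.tgt a)))
      (fun a => by rw [← map_mul, mul_assoc, vertexElem_mul_self])
      (by simpa only [map_sum, map_mul] using hx)
    refine Finset.sum_eq_zero fun a _ => ?_
    rw [ih _ (mul_vertex_mem_lengthFiltration (hz a) _) (congrFun h0 a), zero_mul]

end Hereditary

/-! ## Path algebras are hereditary -/

section PathAlgebraHereditary

/-- A vector space `W` regarded as a module over `A` via an algebra homomorphism from `A` to
its endomorphisms. -/
def EndModule {K A W : Type} [Field K] [Ring A] [Algebra K A] [AddCommGroup W] [Module K W]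
    (_ρ : A →ₐ[K] Module.End K W) : Type := W

instance {K A W : Type} [Field K] [Ring A] [Algebra K A] [AddCommGroup W] [Module K W]
    (ρ : A →ₐ[K] Module.End K W) : AddCommGroup (EndModule ρ) :=
  inferInstanceAs (AddCommGroup W)

instance {K A W : Type} [Field K] [Ring A] [Algebra K A] [AddCommGroup W] [Module K W]
    (ρ : A →ₐ[K] Module.End K W) : Module A (EndModule ρ) :=
  Module.compHom W ρ.toRingHom

variable {K Q}

/-- A linear map commuting with the actions of the generators of the path algebra commutes
with the action of the path algebra. -/
lemma map_action_of_generators {W W' : Type} [AddCommGroup W] [Module K W] [AddCommGroup W']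
    [Module K W'] (ρ : PathAlgebra K Q →ₐ[K] Module.End K W)
    (ρ' : PathAlgebra K Q →ₐ[K] Module.End K W') (f : W →ₗ[K] W')
    (vertex : ∀ v w, f (ρ (vertexElem K Q v) w) = ρ' (vertexElem K Q v) (f w))
    (arrow : ∀ a w, f (ρ (arrowElem K Q a) w) = ρ' (arrowElem K Q a) (f w))
    (x : PathAlgebra K Q) (w : W) : f (ρ x w) = ρ' x (f w) := by
  let T : Submodule K (PathAlgebra K Q) := LinearMap.eqLocus
    (LinearMap.llcomp K W W W' f ∘ₗ ρ.toLinearMap) (LinearMap.lcomp K W' f ∘ₗ ρ'.toLinearMap)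
  have hT (y) : y ∈ T ↔ ∀ w, f (ρ y w) = ρ' y (f w) := LinearMap.ext_iff
  suffices x ∈ T from (hT x).1 this w
  rw [eq_top_of_mul_mem T]
  · trivial
  · simp [hT]
  · intro y hy v
    rw [hT] at hy ⊢
    intro w
    rw [map_mul, map_mul, Module.End.mul_apply, Module.End.mul_apply, hy, vertex]
  · intro y hy a
    rw [hT] at hy ⊢
    intro w
    rw [map_mul, map_mul, Module.End.mul_apply, Module.End.mul_apply, hy, arrow]

variable {A : Type} [Ring A] [Algebra K A] (φ : PathAlgebra K Q →ₐ[K] A)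
  {X M : Type} [AddCommGroup X] [Module A X] [Module K X] [IsScalarTower K A X]
  [AddCommGroup M] [Module A M] [Module K M] [IsScalarTower K A M]

/-- The action of the path algebra on the extension of `M` by `X` with cocycle `δ`. -/
def extAction (δ : Q.A → M →ₗ[K] X)
    (hδ : ∀ a m, φ (vertexElem K Q (Q.tgt a)) • δ a m = δ a m)
    (hδ' : ∀ a m, δ a (φ (vertexElem K Q (Q.src a)) • m) = δ a m) :
    PathAlgebra K Q →ₐ[K] Module.End K (X × M) :=
  pathAlgebraLift
    (fun v => (Algebra.lsmul K K X (φ (vertexElem K Q v))).prodMap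
      (Algebra.lsmul K K M (φ (vertexElem K Q v))))
    (fun a => (Algebra.lsmul K K X (φ (arrowElem K Q a))).prodMap
      (Algebra.lsmul K K M (φ (arrowElem K Q a))) + LinearMap.inl K X M ∘ₗ δ a ∘ₗ
        LinearMap.snd K X M)
    (fun i => by
      refine LinearMap.ext fun w => ?_
      simp [← mul_smul, ← map_mul, vertexElem_mul_self])
    (fun i j h => by
      refine LinearMap.ext fun w => ?_
      simp [← mul_smul, ← map_mul, vertexElem_mul_of_ne h])
    (by
      refine LinearMap.ext fun w => ?_
      simp [LinearMap.sum_apply, Prod.ext_iff, Prod.fst_sum, Prod.snd_sum, ← Finset.sum_smul,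
        ← map_sum, sum_vertexElem])
    (fun a => by
      refine LinearMap.ext fun w => ?_
      simp [← mul_smul, ← map_mul, vertexElem_tgt_mul, hδ])
    (fun a => by
      refine LinearMap.ext fun w => ?_
      simp [← mul_smul, ← map_mul, arrowElem_mul_vertexElem_src, hδ'])

section

variable {φ} {δ : Q.A → M →ₗ[K] X}
    {hδ : ∀ a m, φ (vertexElem K Q (Q.tgt a)) • δ a m = δ a m}
    {hδ' : ∀ a m, δ a (φ (vertexElem K Q (Q.src a)) • m) = δ a m}

lemma extAction_vertexElem (v : Q.V) (w : X × M) :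
    extAction φ δ hδ hδ' (vertexElem K Q v) w =
      (φ (vertexElem K Q v) • w.1, φ (vertexElem K Q v) • w.2) := by
  simp [extAction]

lemma extAction_arrowElem (a : Q.A) (w : X × M) :
    extAction φ δ hδ hδ' (arrowElem K Q a) w =
      (φ (arrowElem K Q a) • w.1 + δ a w.2, φ (arrowElem K Q a) • w.2) := by
  simp [extAction]

lemma extAction_inl (x : PathAlgebra K Q) (y : X) :
    extAction φ δ hδ hδ' x (y, 0) = (φ x • y, 0) := by
  refine (map_action_of_generators ((Algebra.lsmul K K X).comp φ) (extAction φ δ hδ hδ')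
    (LinearMap.inl K X M) (fun v w => ?_) (fun a w => ?_) x y).symm
  · simp [extAction_vertexElem]
  · simp [extAction_arrowElem]

end

/-- Over a path algebra, the kernels of epimorphisms out of projectives are projective. -/
lemma projective_ker_of_bijective (hφ : Function.Bijective φ) {P M : Type} [AddCommGroup P]
    [Module A P] [AddCommGroup M] [Module A M] [Module.Projective A P] (p : P →ₗ[A] M)
    (hp : Function.Surjective p) : Module.Projective A (LinearMap.ker p) := by
  refine Module.Projective.of_lifting_property fun {X Y} _ _ _ _ g h hg => ?_
  let _ : Module K P := Module.compHom P (algebraMap K A)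
  have : IsScalarTower K A P := IsScalarTower.of_algebraMap_smul fun _ _ => rfl
  let _ : Module K M := Module.compHom M (algebraMap K A)
  have : IsScalarTower K A M := IsScalarTower.of_algebraMap_smul fun _ _ => rfl
  let _ : Module K X := Module.compHom X (algebraMap K A)
  have : IsScalarTower K A X := IsScalarTower.of_algebraMap_smul fun _ _ => rfl
  let _ : Module K Y := Module.compHom Y (algebraMap K A)
  have : IsScalarTower K A Y := IsScalarTower.of_algebraMap_smul fun _ _ => rfl
  let E : Q.V → A := fun v => φ (vertexElem K Q v)
  let R : Q.A → A := fun a => φ (arrowElem K Q a)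
  have hEE (v) : E v * E v = E v := by simp only [E, ← map_mul, vertexElem_mul_self]
  have hER (a) : E (Q.tgt a) * R a = R a := by simp only [E, R, ← map_mul, vertexElem_tgt_mul]
  have hRE (a) : R a * E (Q.src a) = R a := by
    simp only [E, R, ← map_mul, arrowElem_mul_vertexElem_src]
  -- an equivariant linear section of `p`
  obtain ⟨σ, hpσ, hσ⟩ : ∃ σ : M →ₗ[K] P, (∀ m, p (σ m) = m) ∧
      ∀ v m, E v • σ m = σ (E v • m) := by
    obtain ⟨σ₀, hσ₀⟩ := (p.restrictScalars K).exists_rightInverse_of_surjective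
      (LinearMap.range_eq_top.2 hp)
    replace hσ₀ (m) : p (σ₀ m) = m := LinearMap.congr_fun hσ₀ m
    refine ⟨∑ v, Algebra.lsmul K K P (E v) ∘ₗ σ₀ ∘ₗ Algebra.lsmul K K M (E v), fun m => ?_,
      fun v m => ?_⟩
    · simp only [LinearMap.sum_apply, LinearMap.comp_apply, Algebra.lsmul_coe, map_sum, map_smul,
        hσ₀, ← mul_smul, hEE]
      simp [← Finset.sum_smul, E, ← map_sum, sum_vertexElem]
    · simp only [LinearMap.sum_apply, LinearMap.comp_apply, Algebra.lsmul_coe, Finset.smul_sum,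
        ← mul_smul]
      refine Finset.sum_congr rfl fun w _ => ?_
      by_cases hw : w = v
      · rw [hw, hEE]
      · simp [E, ← map_mul, vertexElem_mul_of_ne hw, vertexElem_mul_of_ne (Ne.symm hw)]
  obtain ⟨τ, hτ⟩ := (g.restrictScalars K).exists_rightInverse_of_surjective
    (LinearMap.range_eq_top.2 hg)
  replace hτ (y) : g (τ y) = y := LinearMap.congr_fun hτ y
  -- the cocycle of the extension `0 → ker p → P → M → 0`
  let κ (a : Q.A) : M →ₗ[K] LinearMap.ker p :=
    (Algebra.lsmul K K P (R a) ∘ₗ σ - σ ∘ₗ Algebra.lsmul K K M (R a)).codRestrict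
      ((LinearMap.ker p).restrictScalars K) fun m => by simp [hpσ]
  have hκ (a m) : (κ a m : P) = R a • σ m - σ (R a • m) := rfl
  have hκt (a m) : E (Q.tgt a) • κ a m = κ a m := by
    ext
    rw [Submodule.coe_smul, hκ, smul_sub, hσ, ← mul_smul, ← mul_smul, hER]
  have hκs (a m) : κ a (E (Q.src a) • m) = κ a m := by
    ext
    rw [hκ, hκ, ← hσ, ← mul_smul, ← mul_smul, hRE]
  let hK : LinearMap.ker p →ₗ[K] Y := h.restrictScalars K
  let δ (a : Q.A) : M →ₗ[K] X := Algebra.lsmul K K X (E (Q.tgt a)) ∘ₗ τ ∘ₗ hK ∘ₗ κ a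
  have hδ (a m) : δ a m = E (Q.tgt a) • τ (h (κ a m)) := rfl
  have hgδ (a m) : g (δ a m) = h (κ a m) := by
    rw [hδ, map_smul, hτ, ← map_smul, hκt]
  let e := AlgEquiv.ofBijective φ hφ
  have he (x) : e.symm (φ x) = x := e.symm_apply_apply x
  let ρX := extAction φ δ (fun a m => by rw [hδ, ← mul_smul, hEE])
    (fun a m => by rw [hδ, hκs, hδ])
  let ρY := extAction φ (fun a => hK ∘ₗ κ a)
    (fun a m => (h.map_smul _ _).symm.trans (congrArg h (hκt a m)))
    (fun a m => congrArg h (hκs a m))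
  have hXv (v w) : ρX (vertexElem K Q v) w = (E v • w.1, E v • w.2) := extAction_vertexElem v w
  have hXa (a w) : ρX (arrowElem K Q a) w = (R a • w.1 + δ a w.2, R a • w.2) :=
    extAction_arrowElem a w
  have hYv (v w) : ρY (vertexElem K Q v) w = (E v • w.1, E v • w.2) := extAction_vertexElem v w
  have hYa (a w) : ρY (arrowElem K Q a) w = (R a • w.1 + h (κ a w.2), R a • w.2) :=
    extAction_arrowElem a w
  let EX := EndModule (ρX.comp e.symm.toAlgHom)
  let EY := EndModule (ρY.comp e.symm.toAlgHom)
  let Γ₀ : X × M →ₗ[K] Y × M := (g.restrictScalars K).prodMap LinearMap.id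
  let Γ : EX →ₗ[A] EY :=
    { toFun := Γ₀
      map_add' := Γ₀.map_add
      map_smul' := fun x w => by
        refine map_action_of_generators ρX ρY Γ₀ (fun v w => ?_) (fun a w => ?_) (e.symm x) w
        · rw [hXv, hYv]
          simp [Γ₀]
        · rw [hXa, hYa]
          simp [Γ₀, hgδ] }
  have hΓ : Function.Surjective Γ := by
    rintro ⟨y, m⟩
    exact ⟨(τ y, m), Prod.ext (hτ y) rfl⟩
  let r : P →ₗ[K] LinearMap.ker p :=
    (LinearMap.id - σ ∘ₗ p.restrictScalars K).codRestrict
      ((LinearMap.ker p).restrictScalars K) fun u => by simp [hpσ]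
  have hr (u) : (r u : P) = u - σ (p u) := rfl
  let Φ₀ : P →ₗ[K] Y × M := (hK ∘ₗ r).prod (p.restrictScalars K)
  have hΦ₀ (u) : Φ₀ u = (h (r u), p u) := rfl
  let Φ : P →ₗ[A] EY :=
    { toFun := Φ₀
      map_add' := Φ₀.map_add
      map_smul' := fun x w => by
        obtain ⟨x, rfl⟩ := hφ.2 x
        have key := map_action_of_generators ((Algebra.lsmul K K P).comp φ) ρY Φ₀
          (fun v w => ?_) (fun a w => ?_) x w
        · refine key.trans ?_
          change ρY x _ = ρY (e.symm (φ x)) _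
          rw [he]
        · change Φ₀ (E v • w) = _
          rw [hΦ₀, hΦ₀, hYv, ← h.map_smul, ← p.map_smul]
          congr 2
          ext
          simp [hr, smul_sub, hσ, E]
        · change Φ₀ (R a • w) = _
          rw [hΦ₀, hΦ₀, hYa, ← h.map_smul, ← p.map_smul]
          refine Prod.ext ?_ rfl
          refine (congrArg h ?_).trans (h.map_add _ _)
          ext
          simp [hr, hκ, smul_sub, R] }
  obtain ⟨q, hq⟩ := Module.projective_lifting_property Γ Φ hΓ
  have hq' (u) : Γ₀ (q u) = Φ₀ u := LinearMap.congr_fun hq u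
  have hq₂ (n : LinearMap.ker p) : (q n : X × M) = ((q n : X × M).1, 0) := by
    refine Prod.ext rfl ?_
    have := congrArg Prod.snd (hq' n)
    exact this.trans n.2
  refine ⟨{ toFun := fun n => (q n : X × M).1, map_add' := ?_, map_smul' := ?_ }, ?_⟩
  · intro n n'
    exact congrArg Prod.fst (q.map_add n n')
  · intro x n
    obtain ⟨x, rfl⟩ := hφ.2 x
    have h1 : (q (φ x • n : LinearMap.ker p) : X × M) = ρX x (q n : X × M) := by
      refine (q.map_smul (φ x) n).trans ?_
      change ρX (e.symm (φ x)) _ = _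
      rw [he]
    rw [hq₂ n, extAction_inl] at h1
    exact congrArg Prod.fst h1
  · ext n
    have h1 := congrArg Prod.fst (hq' n)
    refine h1.trans ?_
    change h (r n) = h n
    congr 1
    ext
    rw [hr, n.2, map_zero, sub_zero]

lemma isHereditaryRing_of_bijective (hφ : Function.Bijective φ) : IsHereditaryRing A := by
  intro M
  let p : (M →₀ A) →ₗ[A] M := Finsupp.linearCombination A id
  have hp : Function.Surjective p := Finsupp.linearCombination_surjective A Function.surjective_id
  exact ⟨ModuleCat.of A (M →₀ A), p, inferInstanceAs (Module.Projective A (M →₀ A)), hp,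
    projective_ker_of_bijective φ hφ p hp⟩

end PathAlgebraHereditary

/-! ## Polynomial functions on representation varieties -/

section RepresentationVarieties

variable {K Q} {d : Q.V → ℕ}

/-- The coordinates of a point of the space of representations. -/
def repCoord (M : RepSpace K Q d) (x : Q.A × RepIx Q d × RepIx Q d) : K := M x.1 x.2.1 x.2.2

variable (K d) in
/-- The algebra of polynomial functions on the space of representations. -/
def polyFun : Subalgebra K (RepSpace K Q d → K) :=
  (MvPolynomial.aeval fun x M => repCoord M x).range

lemma mem_polyFun_iff {f : RepSpace K Q d → K} :
    f ∈ polyFun K d ↔ ∃ F : MvPolynomial (Q.A × RepIx Q d × RepIx Q d) K,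
      ∀ M, MvPolynomial.eval (repCoord M) F = f M := by
  have key (F : MvPolynomial (Q.A × RepIx Q d × RepIx Q d) K) (M : RepSpace K Q d) :
      MvPolynomial.aeval (fun x (M : RepSpace K Q d) => repCoord M x) F M =
        MvPolynomial.eval (repCoord M) F := by
    have : (Pi.evalAlgHom K (fun _ : RepSpace K Q d => K) M).comp
        (MvPolynomial.aeval fun x (M : RepSpace K Q d) => repCoord M x) =
        MvPolynomial.aeval (repCoord M) := by
      ext; simp
    exact DFunLike.congr_fun this F
  simp only [polyFun, AlgHom.mem_range, funext_iff, key]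

lemma entry_mem_polyFun (a : Q.A) (u v : RepIx Q d) :
    (fun M : RepSpace K Q d => M a u v) ∈ polyFun K d :=
  mem_polyFun_iff.2 ⟨MvPolynomial.X (a, u, v), fun M => by simp [repCoord]⟩

lemma const_mem_polyFun (x : K) : (fun _ : RepSpace K Q d => x) ∈ polyFun K d :=
  (polyFun K d).algebraMap_mem x

lemma prod_entry_mem_polyFun (l : List Q.A) (u v : RepIx Q d) :
    (fun M : RepSpace K Q d => (l.map M).prod u v) ∈ polyFun K d := by
  induction l generalizing u with
  | nil => simpa using const_mem_polyFun _
  | cons a l ih =>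
    simp only [List.map_cons, List.prod_cons, Matrix.mul_apply]
    convert (polyFun K d).sum_mem fun w (_ : w ∈ Finset.univ) =>
      (polyFun K d).mul_mem (entry_mem_polyFun a u w) (ih w) using 1
    ext M
    simp

lemma det_mem_polyFun {n : Type} [Fintype n] [DecidableEq n]
    {Y : RepSpace K Q d → Matrix n n K} (hY : ∀ r s, (fun M => Y M r s) ∈ polyFun K d) :
    (fun M => (Y M).det) ∈ polyFun K d := by
  simp only [Matrix.det_apply']
  convert (polyFun K d).sum_mem fun σ (_ : σ ∈ (Finset.univ : Finset (Equiv.Perm n))) =>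
    (polyFun K d).mul_mem (const_mem_polyFun (((Equiv.Perm.sign σ : ℤˣ) : ℤ) : K))
      ((polyFun K d).prod_mem fun i (_ : i ∈ Finset.univ) => hY (σ i) i) using 1
  ext M
  simp

lemma isOpen_setOf_ne_zero {f : RepSpace K Q d → K} (hf : f ∈ polyFun K d) :
    @IsOpen _ (repTopology K Q d) {M | f M ≠ 0} := by
  obtain ⟨F, hF⟩ := mem_polyFun_iff.1 hf
  refine (@isOpen_induced_iff _ _ (zariskiTopology _ K) _ _).2 ⟨{x | MvPolynomial.eval x F ≠ 0},
    TopologicalSpace.isOpen_generateFrom_of_mem ⟨F, rfl⟩, ?_⟩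
  ext M
  exact not_congr (by rw [← hF]; rfl)

/-- Polynomial functions that do not vanish identically on an irreducible set have a common
nonvanishing point. -/
lemma exists_forall_ne_zero {Z : Set (RepSpace K Q d)} (hZ : @IsIrreducible _ (repTopology K Q d) Z)
    {ι : Type} (s : Finset ι) (f : ι → RepSpace K Q d → K) (hf : ∀ i ∈ s, f i ∈ polyFun K d)
    (h : ∀ i ∈ s, ∃ M ∈ Z, f i M ≠ 0) : ∃ M ∈ Z, ∀ i ∈ s, f i M ≠ 0 := by
  classical
  induction s using Finset.induction_on with
  | empty => simpa using! hZ.1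
  | insert i s his ih =>
    obtain ⟨M₁, hM₁, h₁⟩ := ih (fun j hj => hf j (Finset.mem_insert_of_mem hj))
      fun j hj => h j (Finset.mem_insert_of_mem hj)
    obtain ⟨M₂, hM₂, h₂⟩ := h i (Finset.mem_insert_self i s)
    obtain ⟨M, hM, hMi, hMs⟩ := hZ.2 _ _ (isOpen_setOf_ne_zero (hf i (Finset.mem_insert_self i s)))
      (isOpen_setOf_ne_zero ((polyFun K d).prod_mem fun j hj =>
        hf j (Finset.mem_insert_of_mem hj))) ⟨M₂, hM₂, h₂⟩
      ⟨M₁, hM₁, by simpa [Finset.prod_eq_zero_iff] using h₁⟩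
    refine ⟨M, hM, fun j hj => ?_⟩
    obtain rfl | hj := Finset.mem_insert.1 hj
    · exact hMi
    · exact (by simpa [Finset.prod_eq_zero_iff] using hMs : ∀ j ∈ s, f j M ≠ 0) j hj

lemma exists_eval_ne_zero_of_isOpen {ι : Type} {U : Set (ι → K)}
    (hU : @IsOpen _ (zariskiTopology ι K) U) {x : ι → K} (hx : x ∈ U) :
    ∃ f : MvPolynomial ι K, MvPolynomial.eval x f ≠ 0 ∧
      ∀ y, MvPolynomial.eval y f ≠ 0 → y ∈ U := by
  change TopologicalSpace.GenerateOpen _ U at hU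
  induction hU with
  | basic U hU =>
    obtain ⟨f, rfl⟩ := hU
    exact ⟨f, hx, fun _ => id⟩
  | univ => exact ⟨1, by simp, fun _ _ => trivial⟩
  | inter U V _ _ ihU ihV =>
    obtain ⟨f, hf, hfU⟩ := ihU hx.1
    obtain ⟨g, hg, hgV⟩ := ihV hx.2
    refine ⟨f * g, by simp [hf, hg], fun y hy => ?_⟩
    rw [map_mul] at hy
    exact ⟨hfU y (left_ne_zero_of_mul hy), hgV y (right_ne_zero_of_mul hy)⟩
  | sUnion S _ ih =>
    obtain ⟨U, hU, hxU⟩ := hx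
    obtain ⟨f, hf, hfU⟩ := ih U hU hxU
    exact ⟨f, hf, fun y hy => ⟨U, hU, hfU y hy⟩⟩

/-- The pullback of a polynomial to a line. -/
lemma exists_polynomial_eval_line {ι : Type} (f : MvPolynomial ι K) (x y : ι → K) :
    ∃ p : Polynomial K, ∀ t, p.eval t = MvPolynomial.eval (x + t • (y - x)) f := by
  refine ⟨MvPolynomial.aeval
    (fun i => Polynomial.C (x i) + Polynomial.X * Polynomial.C (y i - x i)) f, fun t => ?_⟩
  have : (Polynomial.aeval t).comp (MvPolynomial.aeval
      (fun i => Polynomial.C (x i) + Polynomial.X * Polynomial.C (y i - x i))) =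
      MvPolynomial.aeval (R := K) (x + t • (y - x)) := by
    ext; simp
  exact DFunLike.congr_fun this f

variable (K d) in
lemma isIrreducible_setOf_blockCompatible [Infinite K] :
    @IsIrreducible _ (repTopology K Q d) {M | BlockCompatible K Q d M} := by
  refine ⟨⟨0, fun a u v h => absurd rfl h⟩, ?_⟩
  intro U V hU hV ⟨M₁, hM₁, hM₁U⟩ ⟨M₂, hM₂, hM₂V⟩
  obtain ⟨U, hU', rfl⟩ := (@isOpen_induced_iff _ _ (zariskiTopology _ K) _ _).1 hU
  obtain ⟨V, hV', rfl⟩ := (@isOpen_induced_iff _ _ (zariskiTopology _ K) _ _).1 hV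
  obtain ⟨f, hf, hfU⟩ := exists_eval_ne_zero_of_isOpen hU' hM₁U
  obtain ⟨g, hg, hgV⟩ := exists_eval_ne_zero_of_isOpen hV' hM₂V
  obtain ⟨p, hp⟩ := exists_polynomial_eval_line f (repCoord M₁) (repCoord M₂)
  obtain ⟨q, hq⟩ := exists_polynomial_eval_line g (repCoord M₁) (repCoord M₂)
  have hp0 : p ≠ 0 := by
    rintro rfl
    exact hf (by simpa using! (hp 0).symm)
  have hq0 : q ≠ 0 := by
    rintro rfl
    exact hg (by simpa using! (hq 1).symm)
  obtain ⟨t, ht⟩ : ∃ t, (p * q).eval t ≠ 0 := by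
    by_contra! h
    exact mul_ne_zero hp0 hq0 (Polynomial.funext (by simpa using h))
  rw [Polynomial.eval_mul, hp, hq] at ht
  refine ⟨M₁ + t • (M₂ - M₁), fun a u v h => ?_, hfU _ (left_ne_zero_of_mul ht),
    hgV _ (right_ne_zero_of_mul ht)⟩
  by_cases h₁ : M₁ a u v = 0
  · refine hM₂ a u v fun h₂ => h ?_
    simp [h₁, h₂]
  · exact hM₁ a u v h₁

/-- The action of the path algebra on a representation. -/
def repAction (M : RepSpace K Q d) (hM : BlockCompatible K Q d M) :
    PathAlgebra K Q →ₐ[K] Matrix (RepIx Q d) (RepIx Q d) K :=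
  pathAlgebraLift (fun i => Matrix.diagonal fun u => if u.1 = i then 1 else 0) M
    (fun i => by simp)
    (fun i j h => by
      rw [Matrix.diagonal_mul_diagonal, ← Matrix.diagonal_zero]
      congr 1
      ext u
      grind)
    (by
      ext u v
      rw [Matrix.sum_apply]
      simp only [Matrix.diagonal_apply, Matrix.one_apply]
      by_cases h : u = v <;> simp [h])
    (fun a => by
      ext u v
      have := hM a u v
      grind [Matrix.diagonal_mul])
    (fun a => by
      ext u v
      have := hM a u v
      grind [Matrix.mul_diagonal])

lemma relEval_eq (M : RepSpace K Q d) (hM : BlockCompatible K Q d M) (c : QPath Q →₀ K) :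
    relEval K Q d M c = repAction M hM (relElem K Q c) := by
  rw [map_relElem]
  simp [relEval, pathProd, repAction]

lemma isGeomIrreducible_of_injective [Infinite K] {A : Type} [Ring A] [Algebra K A]
    {φ : PathAlgebra K Q →ₐ[K] A} (hφ : Function.Injective φ) : IsGeomIrreducible K Q φ := by
  intro d
  convert isIrreducible_setOf_blockCompatible K d using 1
  ext M
  refine ⟨fun h => h.1, fun h => ⟨h, fun c i j _ hc => ?_⟩⟩
  rw [relEval_eq M h, (map_eq_zero_iff φ hφ).1 hc, map_zero]

end RepresentationVarieties

/-! ## Heights in acyclic quivers -/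

section Height

variable {Q}

/-- If the lengths of the paths are bounded, there is a function strictly increasing along the
arrows. -/
lemma exists_height {m : ℕ} (hm : ∀ p : QPath Q, p.length < m) :
    ∃ ht : Q.V → ℕ, ∀ a, ht (Q.src a) < ht (Q.tgt a) := by
  let S (v : Q.V) : Set ℕ := {n | ∃ l : List Q.A, l.IsChain (fun a b => Q.src a = Q.tgt b) ∧
    (∀ a ∈ l.head?, Q.tgt a = v) ∧ l.length = n}
  have hS (v) : BddAbove (S v) := by
    refine ⟨m, ?_⟩
    rintro _ ⟨l, hl, -, rfl⟩
    by_cases h : l = []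
    · simp [h]
    · exact (hm ⟨l, h, hl⟩).le
  refine ⟨fun v => sSup (S v), fun a => ?_⟩
  obtain ⟨l, hl, hla, hn⟩ := Nat.sSup_mem (s := S (Q.src a)) ⟨0, [], .nil, by simp, rfl⟩ (hS (Q.src a))
  refine Nat.lt_of_succ_le (le_csSup (hS _) ⟨a :: l, ?_, by simp, ?_⟩)
  · exact List.isChain_cons.2 ⟨fun b hb => (hla b hb).symm, hl⟩
  · rw [List.length_cons, hn]

variable {ht : Q.V → ℕ}

lemma height_tgt_lt (hht : ∀ a, ht (Q.src a) < ht (Q.tgt a)) {h : Q.A} {l : List Q.A}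
    (hl : (h :: l).IsChain fun a b => Q.src a = Q.tgt b) {a : Q.A} (ha : a ∈ l) :
    ht (Q.tgt a) < ht (Q.tgt h) := by
  induction l generalizing h with
  | nil => simp at ha
  | cons b l ih =>
    obtain ⟨hb, hl⟩ := List.isChain_cons_cons.1 hl
    have hlt : ht (Q.tgt b) < ht (Q.tgt h) := hb ▸ hht h
    obtain rfl | ha := List.mem_cons.1 ha
    · exact hlt
    · exact (ih hl ha).trans hlt

lemma height_src_lt (hht : ∀ a, ht (Q.src a) < ht (Q.tgt a)) {h : Q.A} {l : List Q.A}
    (hl : (h :: l).IsChain fun a b => Q.src a = Q.tgt b) {a : Q.A} (ha : a ∈ h :: l) :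
    ht (Q.src a) < ht (Q.tgt h) := by
  obtain rfl | ha := List.mem_cons.1 ha
  · exact hht a
  · exact (hht a).trans (height_tgt_lt hht hl ha)

lemma tgt_injOn (hht : ∀ a, ht (Q.src a) < ht (Q.tgt a)) {l : List Q.A}
    (hl : l.IsChain fun a b => Q.src a = Q.tgt b) {a b : Q.A} (ha : a ∈ l) (hb : b ∈ l)
    (hab : Q.tgt a = Q.tgt b) : a = b := by
  induction l with
  | nil => simp at ha
  | cons h l ih =>
    obtain rfl | ha := List.mem_cons.1 ha <;> obtain hb | hb := List.mem_cons.1 hb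
    · exact hb.symm
    · exact absurd (height_tgt_lt hht hl hb) (by rw [hab]; exact lt_irrefl _)
    · exact absurd (height_tgt_lt hht hl ha) (by rw [hab, hb]; exact lt_irrefl _)
    · exact ih hl.tail ha hb

/-- A path through a given set of arrows with pairwise different targets is determined by its
target and its source. -/
lemma chain_unique (hht : ∀ a, ht (Q.src a) < ht (Q.tgt a)) {S : List Q.A}
    (hS : ∀ a ∈ S, ∀ b ∈ S, Q.tgt a = Q.tgt b → a = b) (l l' : List Q.A)
    (hl : l.IsChain fun a b => Q.src a = Q.tgt b) (hl' : l'.IsChain fun a b => Q.src a = Q.tgt b)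
    (h : l ≠ []) (h' : l' ≠ []) (hlS : ∀ a ∈ l, a ∈ S) (hlS' : ∀ a ∈ l', a ∈ S)
    (htgt : Q.tgt (l.head h) = Q.tgt (l'.head h'))
    (hsrc : Q.src (l.getLast h) = Q.src (l'.getLast h')) : l = l' := by
  induction l generalizing l' with
  | nil => exact absurd rfl h
  | cons a l ih =>
    cases l' with
    | nil => exact absurd rfl h'
    | cons b l' =>
      obtain rfl : a = b := hS a (hlS a (by simp)) b (hlS' b (by simp)) htgt
      cases l with
      | nil =>
        cases l' with
        | nil => rfl
        | cons b' l' =>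
          obtain ⟨hb, hl'⟩ := List.isChain_cons_cons.1 hl'
          have := height_src_lt hht hl' (List.getLast_mem (List.cons_ne_nil b' l'))
          rw [← hb] at this
          simp only [List.getLast_singleton, List.getLast_cons_cons] at hsrc
          rw [← hsrc] at this
          exact absurd this (lt_irrefl _)
      | cons a' l =>
        obtain ⟨ha, hl⟩ := List.isChain_cons_cons.1 hl
        cases l' with
        | nil =>
          have := height_src_lt hht hl (List.getLast_mem (List.cons_ne_nil a' l))
          rw [← ha] at this
          simp only [List.getLast_singleton, List.getLast_cons_cons] at hsrc
          rw [hsrc] at this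
          exact absurd this (lt_irrefl _)
        | cons b' l' =>
          obtain ⟨hb, hl'⟩ := List.isChain_cons_cons.1 hl'
          rw [ih (b' :: l') hl hl' (by simp) (by simp)
            (fun c hc => hlS c (List.mem_cons_of_mem _ hc))
            (fun c hc => hlS' c (List.mem_cons_of_mem _ hc)) (ha.symm.trans hb)
            (by simpa using hsrc)]

end Height

/-! ## Geometrically irreducible algebras -/

section GeomIrreducible

variable {K Q} {d : Q.V → ℕ}

/-- A point of the space of representations given by its blocks. -/
def blockPoint (d : Q.V → ℕ) (g : Q.A → ℕ → ℕ → K) : RepSpace K Q d := fun a u v =>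
  if u.1 = Q.tgt a ∧ v.1 = Q.src a then g a u.2 v.2 else 0

lemma blockCompatible_blockPoint (g : Q.A → ℕ → ℕ → K) :
    BlockCompatible K Q d (blockPoint d g) := fun _ _ _ h =>
  not_not.1 fun h' => h (if_neg h')

lemma blockPoint_eq_zero {g : Q.A → ℕ → ℕ → K} {a : Q.A} (h : ∀ r s, g a r s = 0) :
    blockPoint d g a = 0 := by
  ext u v
  simp [blockPoint, h]

lemma mem_repSet {A : Type} [Ring A] [Algebra K A] {φ : PathAlgebra K Q →ₐ[K] A}
    {M : RepSpace K Q d} (hM : BlockCompatible K Q d M)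
    (h : ∀ c i j, IsRelationData K Q c i j → φ (relElem K Q c) = 0 →
      ∀ q ∈ c.support, (q.arrows.map M).prod = 0) : M ∈ RepSet K Q φ d :=
  ⟨hM, fun c i j hc hφ => Finset.sum_eq_zero fun q hq => by
    simp only [pathProd, h c i j hc hφ q hq, smul_zero]⟩

/-- The first basis vector at a vertex. -/
def firstIx (hd : ∀ v, 0 < d v) (v : Q.V) : RepIx Q d := ⟨v, ⟨0, hd v⟩⟩

lemma mul_apply_of_dim_one {M : RepSpace K Q d} (hM : BlockCompatible K Q d M)
    (hd : ∀ v, 0 < d v) {a : Q.A} (ha : d (Q.src a) = 1) (N : Matrix (RepIx Q d) (RepIx Q d) K)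
    (u v : RepIx Q d) :
    (M a * N) u v = M a u (firstIx hd (Q.src a)) * N (firstIx hd (Q.src a)) v := by
  rw [Matrix.mul_apply]
  refine Finset.sum_eq_single _ (fun w _ hw => ?_) (by simp)
  by_cases h : M a u w = 0
  · rw [h, zero_mul]
  · refine absurd ?_ hw
    obtain ⟨w, k, hk⟩ := w
    obtain rfl : w = Q.src a := (hM a _ _ h).2
    have : k = 0 := by omega
    subst this
    rfl

lemma prod_apply_of_dim_one {M : RepSpace K Q d} (hM : BlockCompatible K Q d M)
    (hd : ∀ v, 0 < d v) {l : List Q.A} (hl : l.IsChain fun a b => Q.src a = Q.tgt b)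
    (h : l ≠ []) (hd1 : ∀ a ∈ l, d (Q.src a) = 1) :
    (l.map M).prod (firstIx hd (Q.tgt (l.head h))) (firstIx hd (Q.src (l.getLast h))) =
      (l.map fun a => M a (firstIx hd (Q.tgt a)) (firstIx hd (Q.src a))).prod := by
  induction l with
  | nil => exact absurd rfl h
  | cons a l ih =>
    cases l with
    | nil => simp
    | cons b l =>
      obtain ⟨hab, hl⟩ := List.isChain_cons_cons.1 hl
      have := ih hl (by simp) fun c hc => hd1 c (List.mem_cons_of_mem _ hc)
      rw [List.map_cons, List.prod_cons, mul_apply_of_dim_one hM hd (hd1 a (by simp)),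
        List.map_cons (a := a), List.prod_cons, ← this]
      simp [hab]

variable {A : Type} [Ring A] [Algebra K A] {φ : PathAlgebra K Q →ₐ[K] A}

/-- No path of length at least two vanishes in a geometrically irreducible algebra. -/
lemma map_pathElem_ne_zero (hirr : IsGeomIrreducible K Q φ)
    (hnoloop : ∀ a : Q.A, Q.src a ≠ Q.tgt a) (p : QPath Q) (hp : 2 ≤ p.length) :
    φ (pathElem K Q p) ≠ 0 := by
  intro hφ
  have hd : ∀ v : Q.V, 0 < (fun _ : Q.V => 1) v := fun _ => one_pos
  obtain ⟨M, hM, hne⟩ := exists_forall_ne_zero (hirr fun _ => 1) Finset.univ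
    (fun a M => M a (firstIx hd (Q.tgt a)) (firstIx hd (Q.src a)))
    (fun a _ => entry_mem_polyFun a _ _) fun a _ => by
      refine ⟨blockPoint _ fun b _ _ => if b = a then 1 else 0,
        mem_repSet (blockCompatible_blockPoint _) fun c i j hc _ q hq => ?_, ?_⟩
      · refine prod_eq_zero_of_mul_eq_zero (fun b b' hb => ?_) q (hc q hq).1
        by_cases h : b = a
        · have : b' ≠ a := by
            rintro rfl
            exact hnoloop b' (h ▸ hb)
          rw [blockPoint_eq_zero (a := b') (by simp [this]), mul_zero]
        · rw [blockPoint_eq_zero (a := b) (by simp [h]), zero_mul]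
      · simp [blockPoint, firstIx]
  have h0 := hM.2 (Finsupp.single p 1) p.tgt p.src (fun q hq => by
    obtain rfl : q = p := by
      simpa using Finsupp.support_single_subset hq
    exact ⟨hp, rfl, rfl⟩) (by simpa [relElem] using hφ)
  have h1 : (p.arrows.map M).prod = 0 := by simpa [relEval, pathProd] using h0
  have h2 := prod_apply_of_dim_one hM.1 hd p.chain p.ne fun _ _ => rfl
  rw [h1, Matrix.zero_apply] at h2
  refine List.prod_ne_zero ?_ h2.symm
  simp [hne]

end GeomIrreducible

section MinimalRelation

variable {K Q}

lemma QPath.ext_arrows {p q : QPath Q} (h : p.arrows = q.arrows) : p = q := by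
  cases p
  cases q
  cases h
  rfl

lemma QPath.exists_tail (p : QPath Q) (hp : 2 ≤ p.length) : ∃ ne : p.arrows.tail ≠ [],
    Q.src (p.arrows.head p.ne) = Q.tgt (p.arrows.tail.head ne) ∧
      Q.src (p.arrows.tail.getLast ne) = p.src ∧
      p.arrows.tail.IsChain fun a b => Q.src a = Q.tgt b := by
  obtain ⟨l, ne, chain⟩ := p
  match l, ne, chain, hp with
  | a :: b :: l, _, chain, _ =>
    obtain ⟨hab, hl⟩ := List.isChain_cons_cons.1 chain
    exact ⟨List.cons_ne_nil b l, hab, by simp [QPath.src], hl⟩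

variable {A : Type} [Ring A] [Algebra K A] {φ : PathAlgebra K Q →ₐ[K] A}

/-- If the algebra has nonzero relations, then some relation contains a path such that every
path in a relation through the vertices of this path has the same target. -/
lemma exists_minimal_relation {ht : Q.V → ℕ} (hht : ∀ a, ht (Q.src a) < ht (Q.tgt a))
    {c₀ : QPath Q →₀ K} {i₀ j₀ : Q.V} (hc₀ : IsRelationData K Q c₀ i₀ j₀)
    (hφ₀ : φ (relElem K Q c₀) = 0) (hne : c₀ ≠ 0) :
    ∃ (c : QPath Q →₀ K) (i j : Q.V), IsRelationData K Q c i j ∧ φ (relElem K Q c) = 0 ∧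
      ∃ p ∈ c.support, ∀ c' i' j', IsRelationData K Q c' i' j' → φ (relElem K Q c') = 0 →
        ∀ q ∈ c'.support, (∀ a ∈ q.arrows, a ∈ p.arrows) → q.tgt = i := by
  let P (W : Finset Q.V) : Prop := ∃ (c : QPath Q →₀ K) (i j : Q.V), IsRelationData K Q c i j ∧
    φ (relElem K Q c) = 0 ∧ ∃ p ∈ c.support, ∀ a ∈ p.arrows, Q.src a ∈ W ∧ Q.tgt a ∈ W
  obtain ⟨p₀, hp₀⟩ := Finsupp.support_nonempty_iff.2 hne
  obtain ⟨W, ⟨c, i, j, hc, hφ, p, hp, hpW⟩, hW⟩ := exists_minimal_of_wellFoundedLT P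
    ⟨Finset.univ, c₀, i₀, j₀, hc₀, hφ₀, p₀, hp₀, by simp⟩
  have key (c' i' j') (hc' : IsRelationData K Q c' i' j') (hφ' : φ (relElem K Q c') = 0)
      (q) (hq : q ∈ c'.support) (hqW : ∀ a ∈ q.arrows, Q.src a ∈ W ∧ Q.tgt a ∈ W) :
      q.tgt ∈ W ∧ ∀ v ∈ W, v = q.tgt ∨ ht v < ht q.tgt := by
    refine ⟨(hqW _ (List.head_mem q.ne)).2, fun v hv => ?_⟩
    have hmin := @hW ((q.arrows.map Q.src ++ q.arrows.map Q.tgt).toFinset)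
      ⟨c', i', j', hc', hφ', q, hq, fun a ha => by
        simp only [List.mem_toFinset, List.mem_append, List.mem_map]
        exact ⟨.inl ⟨a, ha, rfl⟩, .inr ⟨a, ha, rfl⟩⟩⟩
      (fun w hw => by
        simp only [List.mem_toFinset, List.mem_append, List.mem_map] at hw
        obtain ⟨a, ha, rfl⟩ | ⟨a, ha, rfl⟩ := hw
        exacts [(hqW a ha).1, (hqW a ha).2])
    have hv' := hmin hv
    simp only [List.mem_toFinset, List.mem_append, List.mem_map] at hv'
    obtain ⟨l, ne, chain⟩ := q
    cases l with
    | nil => exact absurd rfl ne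
    | cons h l =>
      obtain ⟨a, ha, rfl⟩ | ⟨a, ha, rfl⟩ := hv'
      · exact .inr (height_src_lt hht chain ha)
      · obtain rfl | ha := List.mem_cons.1 ha
        · exact .inl rfl
        · exact .inr (height_tgt_lt hht chain ha)
  refine ⟨c, i, j, hc, hφ, p, hp, fun c' i' j' hc' hφ' q hq hqp => ?_⟩
  obtain ⟨h₁, h₂⟩ := key c i j hc hφ p hp hpW
  obtain ⟨h₃, h₄⟩ := key c' i' j' hc' hφ' q hq fun a ha => hpW a (hqp a ha)
  rw [← (hc p hp).2.1]
  obtain h | h := h₂ _ h₃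
  · exact h
  · obtain h' | h' := h₄ _ h₁
    · exact h'.symm
    · exact absurd h h'.asymm

/-- The sum of the tails of the paths in a linear combination starting with a given arrow. -/
def tailCoeff {d : Q.V → ℕ} (c : QPath Q →₀ K) (M : RepSpace K Q d) (u v : RepIx Q d)
    (b : Q.A) : K :=
  ∑ q ∈ c.support with q.arrows.head q.ne = b, c q * (q.arrows.tail.map M).prod u v

lemma tailCoeff_mem_polyFun {d : Q.V → ℕ} (c : QPath Q →₀ K) (u v : RepIx Q d) (b : Q.A) :
    (fun M => tailCoeff c M u v b) ∈ polyFun K d := by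
  convert (polyFun K d).sum_mem fun q (_ : q ∈ c.support.filter fun q => q.arrows.head q.ne = b) =>
    (polyFun K d).mul_mem (const_mem_polyFun (c q)) (prod_entry_mem_polyFun q.arrows.tail u v)
    using 1
  ext M
  simp [tailCoeff]

lemma relEval_apply {d : Q.V → ℕ} {c : QPath Q →₀ K} {i j : Q.V} (hc : IsRelationData K Q c i j)
    {M : RepSpace K Q d} (hM : BlockCompatible K Q d M) (hd : ∀ v, 0 < d v)
    (hd1 : ∀ v, v ≠ i → d v = 1) (hnoloop : ∀ a : Q.A, Q.src a ≠ Q.tgt a) (u v : RepIx Q d) :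
    relEval K Q d M c u v = ∑ b with Q.tgt b = i,
      M b u (firstIx hd (Q.src b)) * tailCoeff c M (firstIx hd (Q.src b)) v b := by
  have hhead {q} (hq : q ∈ c.support) : Q.tgt (q.arrows.head q.ne) = i := (hc q hq).2.1
  rw [relEval, Finsupp.sum, Matrix.sum_apply, ← Finset.sum_fiberwise_of_maps_to
    (t := Finset.univ.filter fun b => Q.tgt b = i) (g := fun q : QPath Q => q.arrows.head q.ne)
    fun q hq => by simpa using hhead hq]
  refine Finset.sum_congr rfl fun b _ => ?_
  rw [tailCoeff, Finset.mul_sum]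
  refine Finset.sum_congr rfl fun q hq => ?_
  obtain ⟨hq', rfl⟩ := Finset.mem_filter.1 hq
  have hsrc : Q.src (q.arrows.head q.ne) ≠ i := by
    rw [← hhead hq']
    exact hnoloop _
  have hprod : pathProd K Q d M q = M (q.arrows.head q.ne) * (q.arrows.tail.map M).prod := by
    rw [pathProd, ← List.prod_cons, ← List.map_cons, List.cons_head_tail]
  rw [hprod, Matrix.smul_apply, mul_apply_of_dim_one hM hd (hd1 _ hsrc), smul_eq_mul]
  ring

/-- The relations of a geometrically irreducible algebra are trivial. -/
lemma relation_eq_zero (hirr : IsGeomIrreducible K Q φ) (hadm : IsAdmissiblePresentation K Q φ)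
    (hnoloop : ∀ a : Q.A, Q.src a ≠ Q.tgt a) {c₀ : QPath Q →₀ K} {i₀ j₀ : Q.V}
    (hc₀ : IsRelationData K Q c₀ i₀ j₀) (hφ₀ : φ (relElem K Q c₀) = 0) : c₀ = 0 := by
  by_contra hne
  obtain ⟨-, -, m, hm, hφm⟩ := hadm
  obtain ⟨ht, hht⟩ : ∃ ht : Q.V → ℕ, ∀ a, ht (Q.src a) < ht (Q.tgt a) :=
    exists_height (m := m) fun p => lt_of_not_ge fun h =>
      map_pathElem_ne_zero hirr hnoloop p (hm.trans h) (hφm p h)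
  obtain ⟨c, i, j, hc, hφ, p, hp, hmin⟩ := exists_minimal_relation hht hc₀ hφ₀ hne
  obtain ⟨hp2, hpi, hpj⟩ := hc p hp
  obtain ⟨hpne, hptgt, hpsrc, hpchain⟩ := p.exists_tail hp2
  let h := p.arrows.head p.ne
  have hcons : h :: p.arrows.tail = p.arrows := List.cons_head_tail p.ne
  have hlt (a) (ha : a ∈ p.arrows.tail) : ht (Q.tgt a) < ht i :=
    hpi ▸ height_tgt_lt hht (hcons.symm ▸ p.chain) ha
  let e : Q.A ≃ Fin (Fintype.card Q.A) := Fintype.equivFin Q.A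
  let d (v : Q.V) : ℕ := if v = i then Fintype.card Q.A else 1
  have hdi : d i = Fintype.card Q.A := if_pos rfl
  have hd1 (v) (hv : v ≠ i) : d v = 1 := if_neg hv
  have hd (v) : 0 < d v := by
    by_cases hv : v = i
    · rw [hv, hdi]
      exact Fintype.card_pos_iff.2 ⟨h⟩
    · rw [hd1 v hv]
      exact one_pos
  let row (a : Q.A) : RepIx Q d := ⟨i, Fin.cast hdi.symm (e a)⟩
  let C (M : RepSpace K Q d) (b : Q.A) : K := tailCoeff c M (firstIx hd (Q.src b)) (firstIx hd j) b
  let Y (M : RepSpace K Q d) : Matrix Q.A Q.A K := fun a b =>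
    if Q.tgt b = i then M b (row a) (firstIx hd (Q.src b)) else if a = b then 1 else 0
  have hC (M) (b) (hb : Q.tgt b ≠ i) : C M b = 0 := by
    refine Finset.sum_eq_zero fun q hq => absurd ?_ hb
    obtain ⟨hq', rfl⟩ := Finset.mem_filter.1 hq
    exact (hc q hq').2.1
  have hYC (M) (hM : M ∈ RepSet K Q φ d) : (Y M).mulVec (C M) = 0 := by
    ext a
    have h0 := relEval_apply hc hM.1 hd hd1 hnoloop (row a) (firstIx hd j)
    rw [hM.2 c i j hc hφ, Matrix.zero_apply, Finset.sum_filter] at h0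
    refine Eq.trans (Finset.sum_congr rfl fun b _ => ?_) h0.symm
    by_cases hb : Q.tgt b = i
    · simp [Y, C, hb]
    · simp [hC M b hb, hb]
  have hU₁ : ∃ M ∈ RepSet K Q φ d, C M h ≠ 0 := by
    let M : RepSpace K Q d := blockPoint d fun a _ _ => if a ∈ p.arrows.tail then 1 else 0
    have hM0 (a) (ha : a ∉ p.arrows.tail) : M a = 0 := blockPoint_eq_zero (by simp [ha])
    have hMl (l : List Q.A) (hl : ¬ ∀ a ∈ l, a ∈ p.arrows.tail) : (l.map M).prod = 0 := by
      push Not at hl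
      obtain ⟨a, ha, ha'⟩ := hl
      exact List.prod_eq_zero (List.mem_map.2 ⟨a, ha, hM0 a ha'⟩)
    refine ⟨M, mem_repSet (blockCompatible_blockPoint _) fun c' i' j' hc' hφ' q hq =>
      hMl _ fun hqp => ?_, ?_⟩
    · have hqi : q.tgt = i := hmin c' i' j' hc' hφ' q hq fun a ha => List.mem_of_mem_tail (hqp a ha)
      have := hlt _ (hqp _ (List.head_mem q.ne))
      exact absurd this (by rw [← hqi]; exact lt_irrefl _)
    · have hCM : C M h = c p * (p.arrows.tail.map M).prod (firstIx hd (Q.src h)) (firstIx hd j) := by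
        refine Finset.sum_eq_single_of_mem p (Finset.mem_filter.2 ⟨hp, rfl⟩) fun q hq hqp => ?_
        obtain ⟨hqc, hqh⟩ := Finset.mem_filter.1 hq
        rw [hMl, Matrix.zero_apply, mul_zero]
        intro hsub
        obtain ⟨hq2, -, hqj⟩ := hc q hqc
        obtain ⟨hqne, hqtgt, hqsrc, hqchain⟩ := q.exists_tail hq2
        refine hqp (QPath.ext_arrows ?_)
        rw [← hcons, ← List.cons_head_tail q.ne, hqh, chain_unique hht
          (fun a ha b hb => tgt_injOn hht hpchain ha hb) _ _ hqchain hpchain hqne hpne hsub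
          (fun _ => id) (by rw [← hqtgt, ← hptgt, hqh]) (by rw [hqsrc, hpsrc, hqj, hpj])]
      have hentry := prod_apply_of_dim_one (blockCompatible_blockPoint _ : BlockCompatible K Q d M)
        hd hpchain hpne fun a ha => hd1 _ fun hai =>
          absurd ((hht a).trans (hlt a ha)) (by rw [hai]; exact lt_irrefl _)
      rw [← hptgt, hpsrc, hpj] at hentry
      rw [hCM, hentry]
      refine mul_ne_zero (Finsupp.mem_support_iff.1 hp) (List.prod_ne_zero ?_)
      simp only [List.mem_map, not_exists, not_and]
      intro a ha
      simp [blockPoint, firstIx, ha]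
  have hU₂ : ∃ M ∈ RepSet K Q φ d, (Y M).det ≠ 0 := by
    let M : RepSpace K Q d := blockPoint d fun a r _ => if Q.tgt a = i ∧ (e a : ℕ) = r then 1 else 0
    refine ⟨M, mem_repSet (blockCompatible_blockPoint _) fun c' i' j' hc' hφ' q hq =>
      prod_eq_zero_of_mul_eq_zero (fun a b hab => ?_) q (hc' q hq).1, ?_⟩
    · by_cases ha : Q.tgt a = i
      · have hb : Q.tgt b ≠ i := by
          rw [← hab, ← ha]
          exact hnoloop a
        rw [show M b = 0 from blockPoint_eq_zero (by simp [hb]), mul_zero]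
      · rw [show M a = 0 from blockPoint_eq_zero (by simp [ha]), zero_mul]
    · have hY : Y M = 1 := by
        ext a b
        by_cases hb : Q.tgt b = i
        · simp [Y, M, hb, blockPoint, row, firstIx, Matrix.one_apply, Fin.val_inj, eq_comm]
        · simp [Y, hb, Matrix.one_apply]
      simp [hY]
  obtain ⟨M₁, hM₁, hCM₁⟩ := hU₁
  obtain ⟨M₂, hM₂, hYM₂⟩ := hU₂
  have hYpoly : (fun M => (Y M).det) ∈ polyFun K d := det_mem_polyFun fun a b => by
    by_cases hb : Q.tgt b = i
    · simpa only [Y, if_pos hb] using entry_mem_polyFun b _ _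
    · simpa only [Y, if_neg hb] using const_mem_polyFun _
  obtain ⟨M, hM, hMC, hMY⟩ := (hirr d).2 _ _
    (isOpen_setOf_ne_zero (tailCoeff_mem_polyFun c (firstIx hd (Q.src h)) (firstIx hd j) h))
    (isOpen_setOf_ne_zero hYpoly) ⟨M₁, hM₁, hCM₁⟩ ⟨M₂, hM₂, hYM₂⟩
  exact hMC (congrFun (Matrix.eq_zero_of_mulVec_eq_zero hMY (hYC M hM)) h)

lemma injective_of_isGeomIrreducible (hirr : IsGeomIrreducible K Q φ)
    (hadm : IsAdmissiblePresentation K Q φ) (hnoloop : ∀ a : Q.A, Q.src a ≠ Q.tgt a) :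
    Function.Injective φ := by
  refine (injective_iff_map_eq_zero φ).2 fun x hx => ?_
  obtain ⟨S, hS, hspan⟩ := hadm.2.1
  have hx' : x ∈ twoSidedSpan (PathAlgebra K Q) S := hspan ▸ hx
  refine AddSubgroup.closure_induction (p := fun x _ => x = 0) ?_ rfl ?_ ?_ hx'
  · rintro _ ⟨a, b, s, hs, rfl⟩
    have hs0 : φ s = 0 := by
      have : s ∈ twoSidedSpan (PathAlgebra K Q) S :=
        AddSubgroup.subset_closure ⟨1, 1, s, hs, by simp⟩
      rwa [hspan] at this
    obtain ⟨c, i, j, hc, rfl⟩ := hS s hs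
    simp [relation_eq_zero hirr hadm hnoloop hc hs0, relElem]
  · rintro x y _ _ rfl rfl
    exact add_zero 0
  · rintro x _ rfl
    exact neg_zero

end MinimalRelation

/-- Let `A = KQ/I` be a finite-dimensional algebra over an algebraically
closed field `K`, where `Q` is a finite quiver containing no loop and `I` is an admissible
ideal of the path algebra `KQ`.  Then `A` is geometrically irreducible if and only if `A`
is hereditary (i.e. the global dimension of `A` is at most `1`). -/
theorem geomIrreducible_iff_hereditary_of_no_loops [IsAlgClosed K]
    (A : Type) [Ring A] [Algebra K A] [Module.Finite K A]
    (φ : PathAlgebra K Q →ₐ[K] A) (hadm : IsAdmissiblePresentation K Q φ)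
    (hnoloop : ∀ a : Q.A, Q.src a ≠ Q.tgt a) :
    IsGeomIrreducible K Q φ ↔ IsHereditaryRing A := by
  refine ⟨fun h => ?_, fun h => ?_⟩
  · exact isHereditaryRing_of_bijective φ
      ⟨injective_of_isGeomIrreducible h hadm hnoloop, hadm.1⟩
  · have : Infinite K := IsAlgClosed.instInfinite
    exact isGeomIrreducible_of_injective (injective_of_projective_arrowPow hnoloop hadm
      (projective_of_isHereditaryRing h (arrowPow φ 1)))
end
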